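/- arXiv:1311.3193 — 3 statements merged into one kernel-verified Lean document; each statement's English description precedes it below -/
import Mathlib

section
/- Let S be a compact set of diameter 1 in a two-dimensional real normed plane that is not angled, and suppose S has a unique completion C. Then for every point x ∈ ∂C \ S there is an open unit-radius circular arc contained in ∂C that contains x, whose two endpoints and whose center all belong to S. -/
open Set

/-- A bounded set is (diametrically) complete if no set of the same diameter
properly contains it. -/
def IsDiamComplete {X : Type*} [MetricSpace X] (C : Set X) : Prop :=
  ¬ ∃ T : Set X, C ⊂ T ∧ Metric.diam T = Metric.diam C

/-- A normed plane is angled if its unit sphere contains two non-collinear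
segments `[a,b]` and `[b,c]`. -/
def Angled (E : Type*) [NormedAddCommGroup E] [NormedSpace ℝ E] : Prop :=
  ∃ a b c : E, ¬ Collinear ℝ ({a, b, c} : Set E) ∧
    segment ℝ a b ∪ segment ℝ b c ⊆ Metric.sphere (0 : E) 1

theorem exists_norming {E : Type*} [NormedAddCommGroup E] [NormedSpace ℝ E] (w : E) :
    ∃ f : E →L[ℝ] ℝ, (∀ v, f v ≤ ‖v‖) ∧ f w = ‖w‖ := by
  obtain ⟨f, hf, hfw⟩ := exists_dual_vector'' ℝ w
  refine ⟨f, fun v => ?_, by simpa using hfw⟩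
  calc f v ≤ ‖f v‖ := le_abs_self _
    _ ≤ ‖f‖ * ‖v‖ := f.le_opNorm v
    _ ≤ 1 * ‖v‖ := by gcongr
    _ = ‖v‖ := one_mul _

/-- If two opposite sides of a quadrilateral with intersecting diagonals of length at most one
have length one, then the sides are parallel chords of a common strip. -/
theorem exists_strip_of_diagonals_meet {E : Type*} [NormedAddCommGroup E] [NormedSpace ℝ E]
    {a b c d o : E} (hac : o ∈ segment ℝ a c) (hbd : o ∈ segment ℝ b d)
    (h1 : ‖a - b‖ = 1) (h2 : ‖d - c‖ = 1) (h3 : ‖a - c‖ ≤ 1) (h4 : ‖d - b‖ ≤ 1)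
    (had : a ≠ d) (hbc : b ≠ c) :
    ∃ f : E →L[ℝ] ℝ, (∀ v, f v ≤ ‖v‖) ∧ f a = f b + 1 ∧ f a = f c + 1 ∧ f d = f b + 1 := by
  obtain ⟨t', t, ht', ht, htt, rfl⟩ := hac
  obtain ⟨s, s', hs, hs', hss, ho⟩ := hbd
  have e1 : a - b = t • (a - c) + s' • (d - b) := by
    have : b = (s + s') • b := by rw [hss, one_smul]
    have ha : a = (t' + t) • a := by rw [htt, one_smul]
    calc a - b = (t' + t) • a - (s + s') • b := by rw [← this, ← ha]
      _ = t • (a - c) + s' • (d - b) + ((t' • a + t • c) - (s • b + s' • d)) := by module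
      _ = _ := by rw [ho]; simp
  have e2 : d - c = t' • (a - c) + s • (d - b) := by
    have : d = (s + s') • d := by rw [hss, one_smul]
    have hc : c = (t' + t) • c := by rw [htt, one_smul]
    calc d - c = (s + s') • d - (t' + t) • c := by rw [← this, ← hc]
      _ = t' • (a - c) + s • (d - b) - ((t' • a + t • c) - (s • b + s' • d)) := by module
      _ = _ := by rw [ho]; simp
  obtain ⟨f, hf, hf1⟩ := exists_norming (a - b)
  have hu : f (a - c) ≤ 1 := (hf _).trans h3
  have hv : f (d - b) ≤ 1 := (hf _).trans h4
  have f1 : t * f (a - c) + s' * f (d - b) = 1 := by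
    rw [← h1, ← hf1, e1]; simp only [map_add, map_smul, smul_eq_mul]
  have f2 : 1 ≤ t' + s := by
    rw [← h2, e2]
    calc _ ≤ ‖t' • (a - c)‖ + ‖s • (d - b)‖ := norm_add_le _ _
      _ = t' * ‖a - c‖ + s * ‖d - b‖ := by
        rw [norm_smul, norm_smul, Real.norm_of_nonneg ht', Real.norm_of_nonneg hs]
      _ ≤ t' * 1 + s * 1 := by gcongr
      _ = _ := by ring
  have hts : t + s' = 1 := by nlinarith
  have t0 : t ≠ 0 := by
    rintro rfl
    have : s' = 1 := by linarith
    have hs0 : s = 0 := by linarith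
    have : t' = 1 := by linarith
    subst_vars
    simp at ho
    exact had ho.symm
  have s0 : s' ≠ 0 := by
    rintro rfl
    have hs0 : s = 1 := by linarith
    have : t = 1 := by linarith
    have : t' = 0 := by linarith
    subst_vars
    simp at ho
    exact hbc ho
  have tp : 0 < t := lt_of_le_of_ne ht t0.symm
  have sp : 0 < s' := lt_of_le_of_ne hs' s0.symm
  have g1 : f (a - c) = 1 := by
    apply le_antisymm hu
    by_contra h
    nlinarith [mul_lt_mul_of_pos_left (not_le.1 h) tp, mul_le_mul_of_nonneg_left hv hs']
  have g2 : f (d - b) = 1 := by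
    apply le_antisymm hv
    by_contra h
    nlinarith [mul_lt_mul_of_pos_left (not_le.1 h) sp, mul_le_mul_of_nonneg_left hu ht]
  rw [h1] at hf1
  rw [map_sub] at g1 g2 hf1
  exact ⟨f, hf, by linarith, by linarith, by linarith⟩

/-- Two unit vectors whose sum has norm two span a segment of the unit sphere. -/
theorem segment_subset_sphere_of_norm_add {E : Type*} [NormedAddCommGroup E] [NormedSpace ℝ E]
    {u v : E} (hu : ‖u‖ ≤ 1) (hv : ‖v‖ ≤ 1) (h : ‖u + v‖ = 2) :
    segment ℝ u v ⊆ Metric.sphere (0 : E) 1 := by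
  obtain ⟨f, hf, hfw⟩ := exists_norming (u + v)
  have h1 := hf u
  have h2 := hf v
  rw [h, map_add] at hfw
  rintro _ ⟨s, t, hs, ht, hst, rfl⟩
  rw [mem_sphere_zero_iff_norm]
  apply le_antisymm
  · calc _ ≤ ‖s • u‖ + ‖t • v‖ := norm_add_le _ _
      _ = s * ‖u‖ + t * ‖v‖ := by
        rw [norm_smul, norm_smul, Real.norm_of_nonneg hs, Real.norm_of_nonneg ht]
      _ ≤ s * 1 + t * 1 := by gcongr
      _ = _ := by linarith
  · have := hf (s • u + t • v)
    have e1 : f u = 1 := by linarith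
    have e2 : f v = 1 := by linarith
    rw [map_add, map_smul, map_smul, e1, e2, smul_eq_mul, smul_eq_mul] at this
    linarith

theorem norm_add_eq_two_of_functional {E : Type*} [NormedAddCommGroup E] [NormedSpace ℝ E]
    {f : E →L[ℝ] ℝ} (hf : ∀ v, f v ≤ ‖v‖) {u v : E} (hu : ‖u‖ ≤ 1) (hv : ‖v‖ ≤ 1)
    (h1 : f u = 1) (h2 : f v = 1) : ‖u + v‖ = 2 := by
  apply le_antisymm
  · linarith [norm_add_le u v]
  · have := hf (u + v)
    rw [map_add, h1, h2] at this
    linarith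

/-- In a plane that is not angled, consecutive segments of the unit sphere stay in one face. -/
theorem functional_eq_one_of_not_angled {E : Type*} [NormedAddCommGroup E] [NormedSpace ℝ E]
    (hang : ¬ Angled E) (f : E →L[ℝ] ℝ) {a b c : E} (hab : a ≠ b)
    (na : ‖a‖ ≤ 1) (nb : ‖b‖ ≤ 1) (nc : ‖c‖ ≤ 1) (h1 : ‖a + b‖ = 2) (h2 : ‖b + c‖ = 2)
    (fa : f a = 1) (fb : f b = 1) : f c = 1 := by
  have hcol : Collinear ℝ ({a, b, c} : Set E) := by
    by_contra hc
    exact hang ⟨a, b, c, hc, union_subset (segment_subset_sphere_of_norm_add na nb h1)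
      (segment_subset_sphere_of_norm_add nb nc h2)⟩
  rw [collinear_iff_of_mem (p₀ := a) (by simp)] at hcol
  obtain ⟨v, hv⟩ := hcol
  obtain ⟨r, hr⟩ := hv b (by simp)
  obtain ⟨s, hs⟩ := hv c (by simp)
  simp only [vadd_eq_add] at hr hs
  have hr0 : r ≠ 0 := by
    rintro rfl
    simp at hr
    exact hab hr.symm
  have : f v = 0 := by
    rw [hr, map_add, map_smul, fa, smul_eq_mul] at fb
    have : r * f v = 0 := by linarith
    simpa [hr0] using this
  rw [hs, map_add, map_smul, this, fa]; simp

/-- A chain of unit vectors, consecutive ones joined by segments of the unit sphere, stays in one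
face of the ball of a plane that is not angled. -/
theorem functional_eq_one_of_chain {E : Type*} [NormedAddCommGroup E] [NormedSpace ℝ E]
    (hang : ¬ Angled E) (f : E →L[ℝ] ℝ) {a b c d e : E} (hab : a ≠ b) (hbd : b ≠ d)
    (na : ‖a‖ ≤ 1) (nb : ‖b‖ ≤ 1) (nc : ‖c‖ ≤ 1) (nd : ‖d‖ ≤ 1) (ne : ‖e‖ ≤ 1)
    (h1 : ‖a + b‖ = 2) (h2 : ‖b + c‖ = 2) (h3 : ‖c + d‖ = 2) (h4 : ‖d + e‖ = 2)
    (fa : f a = 1) (fb : f b = 1) : f d = 1 ∧ f e = 1 := by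
  have fc : f c = 1 := functional_eq_one_of_not_angled hang f hab na nb nc h1 h2 fa fb
  by_cases hbc : b = c
  · subst hbc
    have fd := functional_eq_one_of_not_angled hang f hab na nb nd h1 h3 fa fb
    exact ⟨fd, functional_eq_one_of_not_angled hang f hbd nb nd ne h3 h4 fb fd⟩
  · have fd := functional_eq_one_of_not_angled hang f hbc nb nc nd h2 h3 fb fc
    refine ⟨fd, ?_⟩
    by_cases hcd : c = d
    · subst hcd
      exact functional_eq_one_of_not_angled hang f hbc nb nc ne h2 h4 fb fc
    · exact functional_eq_one_of_not_angled hang f hcd nc nd ne h3 h4 fc fd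

theorem exists_functional_ker_eq_span {E : Type*} [NormedAddCommGroup E] [NormedSpace ℝ E]
    (hdim : Module.finrank ℝ E = 2) {v : E} (hv : v ≠ 0) :
    ∃ ℓ : E →L[ℝ] ℝ, ℓ ≠ 0 ∧ ℓ v = 0 ∧ ∀ z, ℓ z = 0 → ∃ t : ℝ, z = t • v := by
  have : FiniteDimensional ℝ E := FiniteDimensional.of_finrank_pos (by omega)
  have hs := finrank_span_singleton (K := ℝ) hv
  have hlt : Submodule.span ℝ {v} < ⊤ := by
    refine lt_top_iff_ne_top.2 fun h => ?_
    rw [h, finrank_top] at hs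
    omega
  obtain ⟨g, hg, hle⟩ := Submodule.exists_le_ker_of_lt_top _ hlt
  have hk : Submodule.span ℝ {v} = LinearMap.ker g := by
    refine Submodule.eq_of_le_of_finrank_le hle ?_
    have h1 := g.finrank_range_add_finrank_ker
    have h2 : Module.finrank ℝ (LinearMap.range g) = 1 := by
      rw [LinearMap.range_eq_top.2 (LinearMap.surjective hg), finrank_top, Module.finrank_self]
    omega
  refine ⟨LinearMap.toContinuousLinearMap g, fun h => hg ?_, ?_, fun z hz => ?_⟩
  · ext z
    simpa using DFunLike.congr_fun h z
  · have : v ∈ LinearMap.ker g := hle (Submodule.mem_span_singleton_self v)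
    simpa using this
  · have : z ∈ LinearMap.ker g := by simpa using hz
    rw [← hk, Submodule.mem_span_singleton] at this
    obtain ⟨t, ht⟩ := this
    exact ⟨t, ht.symm⟩

/-- A line through the relative interior of a chord that meets the frontier there is a support
line. -/
theorem not_lt_lt_of_mem_frontier_openSegment {E : Type*} [NormedAddCommGroup E]
    [NormedSpace ℝ E] {C : Set E} (hC : Convex ℝ C) (hint : (interior C).Nonempty)
    {z d b : E} (hz : z ∈ C) (hd : d ∈ C) (hb : b ∈ openSegment ℝ z d) (hbC : b ∈ frontier C)
    {ℓ : E →L[ℝ] ℝ} {v : E} (hℓ : ∀ w, ℓ w = 0 → ∃ t : ℝ, w = t • v) {c : ℝ} (hc : c ≠ 0)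
    (hv : d - z = c • v)
    {x y : E} (hx : x ∈ C) (hy : y ∈ C) (h1 : ℓ x < ℓ b) (h2 : ℓ b < ℓ y) : False := by
  obtain ⟨f, hf⟩ := geometric_hahn_banach_open_point hC.interior isOpen_interior hbC.2
  have hle : ∀ w ∈ C, f w ≤ f b := by
    have hcl : closure (interior C) ⊆ {w | f w ≤ f b} :=
      closure_minimal (fun w hw => (hf w hw).le) (isClosed_le f.continuous continuous_const)
    intro w hw
    apply hcl
    rw [hC.closure_interior_eq_closure_of_nonempty_interior hint]
    exact subset_closure hw
  have hfd : f (d - z) = 0 := by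
    obtain ⟨s, t, hs, ht, hst, rfl⟩ := hb
    have a1 := hle z hz
    have a2 := hle d hd
    simp only [map_add, map_smul, smul_eq_mul, map_sub] at a1 a2 ⊢
    have hs' : s = 1 - t := by linarith
    subst hs'
    have : f d ≤ f z := by nlinarith
    have : f z ≤ f d := by nlinarith
    linarith
  have key : ∀ w, ℓ w = 0 → f w = 0 := by
    intro w hw
    obtain ⟨t, rfl⟩ := hℓ w hw
    have : f v = 0 := by
      rw [hv, map_smul, smul_eq_mul] at hfd
      simpa [hc] using hfd
    rw [map_smul, this, smul_zero]
  have hpos1 : 0 < ℓ (y - b) := by rw [map_sub]; linarith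
  have hpos2 : 0 < ℓ (b - x) := by rw [map_sub]; linarith
  have k1 := key (ℓ (y - b) • (b - x) - ℓ (b - x) • (y - b)) (by
    simp only [map_sub, map_smul, smul_eq_mul]; ring)
  rw [map_sub f, map_smul, map_smul, smul_eq_mul, smul_eq_mul, map_sub f, map_sub f] at k1
  have fx := hle x hx
  have fy := hle y hy
  have fxb : f b - f x = 0 := by
    by_contra hne
    have : 0 < f b - f x := lt_of_le_of_ne (by linarith) (Ne.symm hne)
    nlinarith [mul_pos hpos1 this, mul_nonneg hpos2.le (sub_nonneg.2 fy)]
  obtain ⟨w, hw⟩ := hint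
  have k2 := key (ℓ (b - x) • (w - b) - ℓ (w - b) • (b - x)) (by
    simp only [map_sub, map_smul, smul_eq_mul]; ring)
  rw [map_sub f, map_smul, map_smul, smul_eq_mul, smul_eq_mul, map_sub f, map_sub f, fxb] at k2
  have := hf w hw
  have : f w - f b < 0 := by linarith
  nlinarith

theorem isLocalMin_functional_eq_zero {E : Type*} [NormedAddCommGroup E] [NormedSpace ℝ E]
    {C : Set E} {ℓ : E →L[ℝ] ℝ} {w : E} (hw : w ∈ interior C) (h : ∀ y ∈ C, ℓ w ≤ ℓ y) :
    ℓ = 0 := by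
  have hm : IsLocalMin ℓ w := by
    filter_upwards [mem_interior_iff_mem_nhds.1 hw] with y hy using h y hy
  exact hm.hasFDerivAt_eq_zero ℓ.hasFDerivAt

/-- A `T`-periodic parametrization of the frontier of `C` as a simple closed curve. -/
structure FrontierParam {E : Type*} [TopologicalSpace E] (C : Set E) (T : ℝ) (φ : ℝ → E) :
    Prop where
  continuous : Continuous φ
  periodic : ∀ t, φ (t + T) = φ t
  range_eq : range φ = frontier C
  ne : ∀ s t, s < t → t < s + T → φ s ≠ φ t

theorem exists_frontierParam {E : Type*} [NormedAddCommGroup E] [NormedSpace ℝ E]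
    (hdim : Module.finrank ℝ E = 2) {C : Set E} (hC : Convex ℝ C) (hb : Bornology.IsBounded C)
    (hint : (interior C).Nonempty) : ∃ φ : ℝ → E, FrontierParam C (2 * Real.pi) φ := by
  have : FiniteDimensional ℝ E := FiniteDimensional.of_finrank_pos (by omega)
  let e : E ≃L[ℝ] ℂ := ContinuousLinearEquiv.ofFinrankEq (by rw [hdim, Complex.finrank_real_complex])
  obtain ⟨h, -, -, hfr⟩ := exists_homeomorph_image_interior_closure_frontier_eq_unitBall
    (s := e '' C) (hC.linear_image e.toLinearMap)
    (by
      have := e.toHomeomorph.image_interior C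
      have h' : interior (e '' C) = e '' interior C := this.symm
      rw [h']; exact hint.image _)
    (e.lipschitz.isBounded_image hb)
  have hfr' : frontier (e '' C) = e '' frontier C := (e.toHomeomorph.image_frontier C).symm
  have hinj : ∀ s t : ℝ, e.symm (h.symm (Complex.exp (s * Complex.I))) =
      e.symm (h.symm (Complex.exp (t * Complex.I))) → ∃ n : ℤ, s = t + n * (2 * Real.pi) := by
    intro s t hst
    have := h.symm.injective (e.symm.injective hst)
    rw [Complex.exp_eq_exp_iff_exists_int] at this
    obtain ⟨n, hn⟩ := this
    refine ⟨n, ?_⟩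
    have : (s : ℂ) = t + n * (2 * Real.pi) := by
      apply mul_right_cancel₀ Complex.I_ne_zero
      rw [hn]; ring
    exact_mod_cast this
  refine ⟨fun t => e.symm (h.symm (Complex.exp (t * Complex.I))), ?_, ?_, ?_, ?_⟩
  · exact e.symm.continuous.comp (h.symm.continuous.comp (by fun_prop))
  · intro t
    have : Complex.exp (((t + 2 * Real.pi : ℝ) : ℂ) * Complex.I) = Complex.exp (t * Complex.I) := by
      rw [Complex.exp_eq_exp_iff_exists_int]
      exact ⟨1, by push_cast; ring⟩
    simp only [this]
  · ext x
    constructor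
    · rintro ⟨t, rfl⟩
      have : Complex.exp (t * Complex.I) ∈ h '' frontier (e '' C) := by
        rw [hfr]; simp
      obtain ⟨y, hy, hyt⟩ := this
      rw [hfr'] at hy
      obtain ⟨w, hw, rfl⟩ := hy
      simpa [← hyt] using hw
    · intro hx
      have : h (e x) ∈ Metric.sphere (0 : ℂ) 1 := by
        rw [← hfr, hfr']
        exact mem_image_of_mem _ (mem_image_of_mem _ hx)
      rw [mem_sphere_zero_iff_norm] at this
      refine ⟨Complex.arg (h (e x)), ?_⟩
      have h2 := Complex.norm_mul_exp_arg_mul_I (h (e x))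
      rw [this] at h2
      simp only [Complex.ofReal_one, one_mul] at h2
      simp [h2]
  · intro s t hst hts heq
    obtain ⟨n, hn⟩ := hinj s t heq
    have hp := Real.pi_pos
    have h1 : (n : ℝ) < 0 := by nlinarith
    have h2 : (-1 : ℝ) < n := by nlinarith
    have h1' : n < 0 := by exact_mod_cast h1
    have h2' : -1 < n := by exact_mod_cast h2
    omega

namespace FrontierParam

theorem mem_frontier {E : Type*} [TopologicalSpace E] {C : Set E} {T : ℝ} {φ : ℝ → E}
    (h : FrontierParam C T φ) (t : ℝ) : φ t ∈ frontier C :=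
  h.range_eq ▸ mem_range_self t

theorem exists_mem_Ioc {E : Type*} [TopologicalSpace E] {C : Set E} {T : ℝ} {φ : ℝ → E}
    (h : FrontierParam C T φ) (hT : 0 < T) (a : ℝ) {x : E} (hx : x ∈ frontier C) :
    ∃ t ∈ Ioc a (a + T), φ t = x := by
  rw [← h.range_eq] at hx
  obtain ⟨s, rfl⟩ := hx
  obtain ⟨t, ht, hts⟩ := Function.Periodic.exists_mem_Ioc h.periodic hT s a
  exact ⟨t, ht, hts.symm⟩

/-- A connected part of the curve joining two of its points contains one of the two arcs between
them. -/
theorem mem_or_mem_of_isPreconnected {E : Type*} [TopologicalSpace E] [T2Space E] {C : Set E}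
    {T : ℝ} {φ : ℝ → E} (h : FrontierParam C T φ) {t₁ t₂ t₃ t₄ : ℝ} (h12 : t₁ < t₂)
    (h23 : t₂ < t₃) (h34 : t₃ < t₄) (h41 : t₄ < t₁ + T) {I : Set E} (hI : IsPreconnected I)
    (hIC : I ⊆ frontier C) (h2 : φ t₂ ∈ I) (h4 : φ t₄ ∈ I) : φ t₁ ∈ I ∨ φ t₃ ∈ I := by
  have hcl : ∀ s t, IsClosed (φ '' Icc s t) := fun s t =>
    (isCompact_Icc.image h.continuous).isClosed
  obtain ⟨z, hzI, ⟨s, hs, rfl⟩, ⟨s', hs', heq⟩⟩ := isPreconnected_closed_iff.1 hI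
    (φ '' Icc t₁ t₃) (φ '' Icc t₃ (t₁ + T)) (hcl _ _) (hcl _ _)
    (by
      intro z hz
      obtain ⟨s, hs, rfl⟩ := h.exists_mem_Ioc (by linarith) t₁ (hIC hz)
      rcases le_total s t₃ with h' | h'
      · exact Or.inl ⟨s, ⟨hs.1.le, h'⟩, rfl⟩
      · exact Or.inr ⟨s, ⟨h', hs.2⟩, rfl⟩)
    ⟨_, h2, _, ⟨h12.le, h23.le⟩, rfl⟩ ⟨_, h4, _, ⟨h34.le, h41.le⟩, rfl⟩
  rcases (hs.2.trans hs'.1).eq_or_lt with h' | h'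
  · have : s = t₃ := le_antisymm hs.2 (h'.symm ▸ hs'.1)
    exact Or.inr (this ▸ hzI)
  · have h1 : s + T ≤ s' := by
      by_contra hlt
      exact h.ne s s' h' (not_le.1 hlt) heq.symm
    have : s = t₁ := le_antisymm (by linarith [hs'.2]) hs.1
    exact Or.inl (this ▸ hzI)

/-- Interlaced pairs of points of the frontier of a planar convex body span intersecting
segments. -/
theorem exists_mem_segment_inter {E : Type*} [NormedAddCommGroup E] [NormedSpace ℝ E]
    (hdim : Module.finrank ℝ E = 2) {C : Set E} {T : ℝ} {φ : ℝ → E} (h : FrontierParam C T φ)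
    (hC : Convex ℝ C) (hcpt : IsCompact C) (hint : (interior C).Nonempty) {t₁ t₂ t₃ t₄ : ℝ}
    (h12 : t₁ < t₂) (h23 : t₂ < t₃) (h34 : t₃ < t₄) (h41 : t₄ < t₁ + T) :
    ∃ o, o ∈ segment ℝ (φ t₁) (φ t₃) ∧ o ∈ segment ℝ (φ t₂) (φ t₄) := by
  have hsub : frontier C ⊆ C := hcpt.isClosed.frontier_subset
  have hmem : ∀ t, φ t ∈ C := fun t => hsub (h.mem_frontier t)
  have hbd : φ t₂ ≠ φ t₄ := h.ne _ _ (h23.trans h34) (by linarith)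
  obtain ⟨ℓ, hℓ0, hℓv, hℓ⟩ := exists_functional_ker_eq_span hdim (sub_ne_zero.2 hbd.symm)
  have hℓd : ℓ (φ t₄) = ℓ (φ t₂) := by rw [map_sub] at hℓv; linarith
  have support : ∀ g : E →L[ℝ] ℝ, g ≠ 0 → g (φ t₄) = g (φ t₂) → (∀ y ∈ C, g (φ t₂) ≤ g y) →
      ∃ o, o ∈ segment ℝ (φ t₁) (φ t₃) ∧ o ∈ segment ℝ (φ t₂) (φ t₄) := by
    intro g hg0 hgd hg
    have hI : segment ℝ (φ t₂) (φ t₄) ⊆ frontier C := by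
      intro z hz
      refine ⟨subset_closure (hC.segment_subset (hmem _) (hmem _) hz), fun hzi => hg0 ?_⟩
      refine isLocalMin_functional_eq_zero hzi fun y hy => ?_
      obtain ⟨s, t, -, -, hst, rfl⟩ := hz
      have : g (s • φ t₂ + t • φ t₄) = g (φ t₂) := by
        rw [map_add, map_smul, map_smul, hgd, ← add_smul, hst, one_smul]
      rw [this]
      exact hg y hy
    rcases h.mem_or_mem_of_isPreconnected h12 h23 h34 h41
      (convex_segment _ _).isPreconnected hI (left_mem_segment _ _ _) (right_mem_segment _ _ _)
      with h' | h'
    · exact ⟨_, left_mem_segment _ _ _, h'⟩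
    · exact ⟨_, right_mem_segment _ _ _, h'⟩
  by_cases hlow : ∀ y ∈ C, ℓ (φ t₂) ≤ ℓ y
  · exact support ℓ hℓ0 hℓd hlow
  by_cases hup : ∀ y ∈ C, ℓ y ≤ ℓ (φ t₂)
  · refine support (-ℓ) (neg_ne_zero.2 hℓ0) (by simp [hℓd]) fun y hy => ?_
    simpa using hup y hy
  push Not at hlow hup
  obtain ⟨y₁, hy₁, hy₁'⟩ := hlow
  obtain ⟨y₂, hy₂, hy₂'⟩ := hup
  have hne : φ t₄ - φ t₂ ≠ 0 := sub_ne_zero.2 hbd.symm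
  have hline : ∀ z ∈ C, ℓ z = ℓ (φ t₂) → z ∈ segment ℝ (φ t₂) (φ t₄) := by
    intro z hz hzl
    obtain ⟨t, ht⟩ := hℓ (z - φ t₂) (by rw [map_sub]; linarith)
    have hz' : z = φ t₂ + t • (φ t₄ - φ t₂) := by rw [← ht]; abel
    rcases lt_or_ge t 0 with h0 | h0
    · exfalso
      have h1t : 0 < 1 - t := by linarith
      refine not_lt_lt_of_mem_frontier_openSegment hC hint hz (hmem t₄) (b := φ t₂)
        ⟨1 / (1 - t), -t / (1 - t), by positivity, div_pos (by linarith) h1t, by field_simp; ring,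
          ?_⟩ (h.mem_frontier _) hℓ (c := 1 - t) h1t.ne' (by rw [hz']; module) hy₁ hy₂ hy₁' hy₂'
      rw [hz']
      match_scalars <;> field_simp <;> ring
    rcases lt_or_ge 1 t with h1 | h1
    · exfalso
      have h0t : 0 < t := by linarith
      refine not_lt_lt_of_mem_frontier_openSegment hC hint (hmem t₂) hz (b := φ t₄)
        ⟨1 - 1 / t, 1 / t, ?_, by positivity, by ring, ?_⟩ (h.mem_frontier _) hℓ (c := t) h0t.ne'
        ht hy₁ hy₂ (hℓd ▸ hy₁') (hℓd ▸ hy₂')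
      · rw [sub_pos, div_lt_one h0t]; exact h1
      · rw [hz']
        match_scalars
        · field_simp
          ring
        · field_simp
    · rw [segment_eq_image']
      exact ⟨t, ⟨h0, h1⟩, hz'.symm⟩
  have hfr : ∀ z ∈ frontier C, ℓ z = ℓ (φ t₂) → z = φ t₂ ∨ z = φ t₄ := by
    intro z hz hzl
    by_contra hcon
    push Not at hcon
    have := hline z (hsub hz) hzl
    have ho : z ∈ openSegment ℝ (φ t₂) (φ t₄) :=
      mem_openSegment_of_ne_left_right hcon.1.symm hcon.2.symm this
    exact not_lt_lt_of_mem_frontier_openSegment hC hint (hmem t₂) (hmem t₄) ho hz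
      hℓ one_ne_zero (one_smul ℝ _).symm hy₁ hy₂ (hzl ▸ hy₁') (hzl ▸ hy₂')
  have side : ∀ g : E →L[ℝ] ℝ, g ≠ 0 →
      g (φ t₄) = g (φ t₂) →
      (∀ z ∈ frontier C, g z = g (φ t₂) → z = φ t₂ ∨ z = φ t₄) → (∃ y ∈ C, g y < g (φ t₂)) →
      g (φ t₂) < g (φ t₁) → g (φ t₂) < g (φ t₃) → False := by
    rintro g hg0 hgd hg ⟨y, hy, hyl⟩ g1 g3
    have arc : ∀ u v w s, (∀ r ∈ Ioo u v, φ r ≠ φ t₂ ∧ φ r ≠ φ t₄) → w ∈ Ioo u v → s ∈ Ioo u v →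
        g (φ t₂) < g (φ w) → g (φ t₂) ≤ g (φ s) := by
      intro u v w s huv hw hs hgw
      by_contra hlt
      obtain ⟨r, hr, hrg⟩ := (isPreconnected_Ioo (a := u) (b := v)).intermediate_value hs hw
        (g.continuous.comp h.continuous).continuousOn ⟨(not_le.1 hlt).le, hgw.le⟩
      rcases hg _ (h.mem_frontier r) hrg with h' | h'
      · exact (huv r hr).1 h'
      · exact (huv r hr).2 h'
    have all : ∀ z ∈ frontier C, g (φ t₂) ≤ g z := by
      intro z hz
      obtain ⟨s, hs, rfl⟩ := h.exists_mem_Ioc (by linarith) t₂ hz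
      by_cases h4 : φ s = φ t₄
      · rw [h4, hgd]
      by_cases h2 : φ s = φ t₂
      · rw [h2]
      rcases lt_trichotomy s t₄ with h' | h' | h'
      · refine arc t₂ t₄ t₃ s (fun r hr => ⟨?_, ?_⟩) ⟨h23, h34⟩ ⟨hs.1, h'⟩ g3
        · exact (h.ne _ _ hr.1 (by linarith [hr.2])).symm
        · exact h.ne _ _ hr.2 (by linarith [hr.1])
      · exact absurd (congrArg φ h') h4
      · have hs2 : s ≠ t₂ + T := by
          rintro rfl
          exact h2 (h.periodic t₂)
        refine arc t₄ (t₂ + T) (t₁ + T) s (fun r hr => ⟨?_, ?_⟩) ⟨h41, by linarith⟩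
          ⟨h', lt_of_le_of_ne hs.2 hs2⟩ (by rwa [h.periodic])
        · rw [← h.periodic t₂]
          exact h.ne _ _ hr.2 (by linarith [hr.1])
        · exact (h.ne _ _ hr.1 (by linarith [hr.2])).symm
    obtain ⟨w, hw, hwm⟩ := hcpt.exists_isMinOn ⟨y, hy⟩ g.continuous.continuousOn
    by_cases hwi : w ∈ interior C
    · exact hg0 (isLocalMin_functional_eq_zero hwi fun y hy => hwm hy)
    · have := all w ⟨subset_closure hw, hwi⟩
      have h' : g w ≤ g y := hwm hy
      linarith
  have hn : ∀ s, φ s ≠ φ t₂ → φ s ≠ φ t₄ → ℓ (φ s) ≠ ℓ (φ t₂) := fun s h2 h4 hs =>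
    (hfr _ (h.mem_frontier s) hs).elim h2 h4
  have n1 := hn t₁ (h.ne _ _ h12 (by linarith)) (h.ne _ _ (by linarith) h41)
  have n3 := hn t₃ (h.ne _ _ h23 (by linarith)).symm (h.ne _ _ h34 (by linarith))
  have hcont : ContinuousOn ℓ (segment ℝ (φ t₁) (φ t₃)) := ℓ.continuous.continuousOn
  have hpre := (convex_segment (𝕜 := ℝ) (φ t₁) (φ t₃)).isPreconnected
  have fin : ∀ o ∈ segment ℝ (φ t₁) (φ t₃), ℓ o = ℓ (φ t₂) →
      ∃ o, o ∈ segment ℝ (φ t₁) (φ t₃) ∧ o ∈ segment ℝ (φ t₂) (φ t₄) := fun o ho hol =>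
    ⟨o, ho, hline o (hC.segment_subset (hmem _) (hmem _) ho) hol⟩
  rcases n1.lt_or_gt with l1 | l1 <;> rcases n3.lt_or_gt with l3 | l3
  · exact (side (-ℓ) (neg_ne_zero.2 hℓ0) (by simp [hℓd]) (fun z hz hzl => hfr z hz (by simpa using hzl))
      ⟨y₂, hy₂, by simpa using hy₂'⟩ (by simpa using l1) (by simpa using l3)).elim
  · obtain ⟨o, ho, hol⟩ := hpre.intermediate_value (left_mem_segment _ _ _)
      (right_mem_segment _ _ _) hcont ⟨l1.le, l3.le⟩
    exact fin o ho hol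
  · obtain ⟨o, ho, hol⟩ := hpre.intermediate_value (right_mem_segment _ _ _)
      (left_mem_segment _ _ _) hcont ⟨l3.le, l1.le⟩
    exact fin o ho hol
  · exact (side ℓ hℓ0 hℓd hfr ⟨y₁, hy₁, hy₁'⟩ l1 l3).elim

end FrontierParam
/-- Two non-crossing unit chords of a planar convex body of diameter one join the two sides of a
common supporting strip. -/
theorem FrontierParam.exists_strip {E : Type*} [NormedAddCommGroup E] [NormedSpace ℝ E]
    (hdim : Module.finrank ℝ E = 2) {C : Set E} {T : ℝ} {φ : ℝ → E} (h : FrontierParam C T φ)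
    (hC : Convex ℝ C) (hcpt : IsCompact C) (hint : (interior C).Nonempty)
    (hd : ∀ x ∈ C, ∀ y ∈ C, ‖x - y‖ ≤ 1) {a b c d : ℝ}
    (hab : a < b) (hbc : b < c) (hcd : c < d) (hda : d < a + T)
    (h1 : ‖φ a - φ b‖ = 1) (h2 : ‖φ d - φ c‖ = 1) :
    ∃ f : E →L[ℝ] ℝ, (∀ v, f v ≤ ‖v‖) ∧ f (φ a) = f (φ b) + 1 ∧ f (φ a) = f (φ c) + 1 ∧
      f (φ d) = f (φ b) + 1 := by
  have hmem : ∀ t, φ t ∈ C := fun t => hcpt.isClosed.frontier_subset (h.mem_frontier t)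
  obtain ⟨o, hac, hbd⟩ := h.exists_mem_segment_inter hdim hC hcpt hint hab hbc hcd hda
  exact exists_strip_of_diagonals_meet hac hbd h1 h2 (hd _ (hmem _) _ (hmem _))
    (hd _ (hmem _) _ (hmem _)) (h.ne _ _ (by linarith) hda) (h.ne _ _ hbc (by linarith))

theorem FrontierParam.exists_strip_nested {E : Type*} [NormedAddCommGroup E] [NormedSpace ℝ E]
    (hdim : Module.finrank ℝ E = 2) {C : Set E} {T : ℝ} {φ : ℝ → E} (h : FrontierParam C T φ)
    (hC : Convex ℝ C) (hcpt : IsCompact C) (hint : (interior C).Nonempty)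
    (hd : ∀ x ∈ C, ∀ y ∈ C, ‖x - y‖ ≤ 1) {a b c d : ℝ}
    (hab : a < b) (hbc : b < c) (hcd : c < d) (hda : d < a + T)
    (h1 : ‖φ a - φ d‖ = 1) (h2 : ‖φ b - φ c‖ = 1) :
    ∃ f : E →L[ℝ] ℝ, (∀ v, f v ≤ ‖v‖) ∧ f (φ a) = f (φ c) + 1 ∧ f (φ a) = f (φ d) + 1 ∧
      f (φ b) = f (φ c) + 1 ∧ f (φ b) = f (φ d) + 1 := by
  obtain ⟨f, hf, e1, e2, e3⟩ := h.exists_strip hdim hC hcpt hint hd hbc hcd hda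
    (by linarith) h2 (by rwa [h.periodic])
  rw [h.periodic] at e3
  exact ⟨f, hf, by linarith, by linarith, by linarith, by linarith⟩

theorem norm_sub_eq_one_of_functional {E : Type*} [NormedAddCommGroup E] [NormedSpace ℝ E]
    {f : E →L[ℝ] ℝ} (hf : ∀ v, f v ≤ ‖v‖) {x y : E} (h : ‖x - y‖ ≤ 1) (he : f x = f y + 1) :
    ‖x - y‖ = 1 := by
  apply le_antisymm h
  have := hf (x - y)
  rw [map_sub] at this
  linarith

/-- The points of an arc at unit distance from a point outside the arc form an interval. -/
theorem FrontierParam.norm_sub_eq_one_of_between {E : Type*} [NormedAddCommGroup E]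
    [NormedSpace ℝ E] (hdim : Module.finrank ℝ E = 2) {C S : Set E} {T : ℝ} {φ : ℝ → E}
    (h : FrontierParam C T φ) (hC : Convex ℝ C) (hcpt : IsCompact C)
    (hint : (interior C).Nonempty) (hd : ∀ x ∈ C, ∀ y ∈ C, ‖x - y‖ ≤ 1) {α β : ℝ}
    (hopp : ∀ t, ∃ s ∈ Icc β (α + T), φ s ∈ S ∧ ‖φ t - φ s‖ = 1)
    {x y z r : ℝ} (hx : α < x) (hxy : x < y) (hyz : y < z) (hz : z < β) (hr : r ∈ Icc β (α + T))
    (hxr : ‖φ x - φ r‖ = 1) (hzr : ‖φ z - φ r‖ = 1) : ‖φ y - φ r‖ = 1 := by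
  have hmem : ∀ t, φ t ∈ C := fun t => hcpt.isClosed.frontier_subset (h.mem_frontier t)
  obtain ⟨t, ht, -, hyt⟩ := hopp y
  rcases lt_trichotomy t r with h' | h' | h'
  · obtain ⟨f, hf, -, -, -, e⟩ := h.exists_strip_nested hdim hC hcpt hint hd hxy
      (by linarith [ht.1]) h' (by linarith [hr.2]) hxr hyt
    exact norm_sub_eq_one_of_functional hf (hd _ (hmem _) _ (hmem _)) e
  · exact h' ▸ hyt
  · obtain ⟨f, hf, e, -⟩ := h.exists_strip_nested hdim hC hcpt hint hd hyz
      (by linarith [hr.1]) h' (by linarith [ht.2]) hyt hzr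
    exact norm_sub_eq_one_of_functional hf (hd _ (hmem _) _ (hmem _)) e

/-- If the norm is not angled, two points of an arc disjoint from `S` are both at unit distance
from some point of `S`. -/
theorem FrontierParam.exists_common_center {E : Type*} [NormedAddCommGroup E]
    [NormedSpace ℝ E] (hdim : Module.finrank ℝ E = 2) (hang : ¬ Angled E) {C S : Set E} {T : ℝ}
    {φ : ℝ → E} (h : FrontierParam C T φ) (hC : Convex ℝ C) (hcpt : IsCompact C)
    (hint : (interior C).Nonempty) (hd : ∀ x ∈ C, ∀ y ∈ C, ‖x - y‖ ≤ 1) {α β : ℝ}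
    (hopp : ∀ t, ∃ s ∈ Icc β (α + T), φ s ∈ S ∧ ‖φ t - φ s‖ = 1)
    {x k : ℝ} (hx : α < x) (hxk : x < k) (hk : k < β) :
    ∃ r ∈ Icc β (α + T), φ r ∈ S ∧ ‖φ x - φ r‖ = 1 ∧ ‖φ k - φ r‖ = 1 := by
  have hmem : ∀ t, φ t ∈ C := fun t => hcpt.isClosed.frontier_subset (h.mem_frontier t)
  have hle : ∀ s t, ‖φ s - φ t‖ ≤ 1 := fun s t => hd _ (hmem _) _ (hmem _)
  have hone : ∀ {f : E →L[ℝ] ℝ}, (∀ v, f v ≤ ‖v‖) → ∀ {s t}, f (φ s) = f (φ t) + 1 →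
      ‖φ s - φ t‖ = 1 := fun hf s t he => norm_sub_eq_one_of_functional hf (hle s t) he
  have htwo : ∀ {f : E →L[ℝ] ℝ}, (∀ v, f v ≤ ‖v‖) → ∀ {s t u v}, f (φ s) = f (φ t) + 1 →
      f (φ u) = f (φ v) + 1 → ‖(φ s - φ t) + (φ u - φ v)‖ = 2 := fun hf s t u v h1 h2 =>
    norm_add_eq_two_of_functional hf (hle _ _) (hle _ _) (by rw [map_sub]; linarith)
      (by rw [map_sub]; linarith)
  have hdouble : ∀ {s t}, ‖φ s - φ t‖ = 1 → ‖(φ s - φ t) + (φ s - φ t)‖ = 2 := by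
    intro s t hst
    rw [← two_smul ℝ, norm_smul, hst]; norm_num
  have hsplit : ∀ {u v : E}, ‖u‖ ≤ 1 → ‖v‖ ≤ 1 → ‖u + v‖ = 2 → ‖u‖ = 1 ∧ ‖v‖ = 1 := by
    intro u v hu hv huv
    have := norm_add_le u v
    constructor <;> linarith
  have hφ := h.continuous
  obtain ⟨p, hp, hpS, hxp⟩ := hopp x
  obtain ⟨q, hq, hqS, hkq⟩ := hopp k
  rcases lt_trichotomy q p with hpq | hpq | hpq
  · obtain ⟨f, hf, e, -⟩ := h.exists_strip_nested hdim hC hcpt hint hd hxk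
      (by linarith [hq.1]) hpq (by linarith [hp.2]) hxp hkq
    exact ⟨q, hq, hqS, hone hf e, hkq⟩
  · exact ⟨p, hp, hpS, hxp, hpq ▸ hkq⟩
  obtain ⟨m, hm, hm1, hm2⟩ := isPreconnected_closed_iff.1 (isPreconnected_Icc (a := p) (b := q))
    {m | ‖(φ x - φ p) + (φ x - φ m)‖ = 2} {m | ‖(φ k - φ m) + (φ k - φ q)‖ = 2}
    (isClosed_eq (by fun_prop) continuous_const) (isClosed_eq (by fun_prop) continuous_const)
    (by
      intro m hm
      rcases hm.1.eq_or_lt with rfl | hpm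
      · exact Or.inl (hdouble hxp)
      rcases hm.2.eq_or_lt with rfl | hmq
      · exact Or.inr (hdouble hkq)
      obtain ⟨s, hs, -, hms⟩ := hopp m
      rcases lt_trichotomy s m with h' | rfl | h'
      · obtain ⟨f, hf, e1, e2, -⟩ := h.exists_strip_nested hdim hC hcpt hint hd
          (by linarith [hs.1]) h' hmq (by linarith [hq.2]) hkq (by rwa [norm_sub_rev])
        exact Or.inr (htwo hf e1 e2)
      · simp at hms
      · obtain ⟨f, hf, e1, e2, -⟩ := h.exists_strip hdim hC hcpt hint hd
          (by linarith [hp.1]) hpm h' (by linarith [hs.2]) hxp (by rwa [norm_sub_rev])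
        exact Or.inl (htwo hf e1 e2))
    ⟨p, ⟨le_rfl, hpq.le⟩, hdouble hxp⟩ ⟨q, ⟨hpq.le, le_rfl⟩, hdouble hkq⟩
  have hxm := (hsplit (hle _ _) (hle _ _) hm1).2
  have hkm := (hsplit (hle _ _) (hle _ _) hm2).1
  rcases hm.1.eq_or_lt with rfl | hpm
  · exact ⟨p, hp, hpS, hxp, hkm⟩
  by_cases hmS : φ m ∈ S
  · exact ⟨m, ⟨hp.1.trans hm.1, hm.2.trans hq.2⟩, hmS, hxm, hkm⟩
  obtain ⟨y, hy, hy1, hy2⟩ := isPreconnected_closed_iff.1 (isPreconnected_Icc (a := x) (b := k))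
    {y | ‖(φ x - φ m) + (φ y - φ m)‖ = 2} {y | ‖(φ y - φ m) + (φ k - φ m)‖ = 2}
    (isClosed_eq (by fun_prop) continuous_const) (isClosed_eq (by fun_prop) continuous_const)
    (by
      intro y hy
      rcases hy.1.eq_or_lt with rfl | hxy
      · exact Or.inl (hdouble hxm)
      rcases hy.2.eq_or_lt with rfl | hyk
      · exact Or.inr (hdouble hkm)
      obtain ⟨r, hr, hrS, hyr⟩ := hopp y
      rcases lt_trichotomy r m with h' | rfl | h'
      · obtain ⟨f, hf, -, e1, -, e2⟩ := h.exists_strip_nested hdim hC hcpt hint hd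
          hxy (by linarith [hr.1]) h' (by linarith [hm.2, hq.2]) hxm hyr
        exact Or.inl (htwo hf e1 e2)
      · exact absurd hrS hmS
      · obtain ⟨f, hf, e1, -, e2, -⟩ := h.exists_strip_nested hdim hC hcpt hint hd
          hyk (by linarith [hp.1]) h' (by linarith [hr.2]) hyr hkm
        exact Or.inr (htwo hf e1 e2))
    ⟨x, ⟨le_rfl, hxk.le⟩, hdouble hxm⟩ ⟨k, ⟨hxk.le, le_rfl⟩, hdouble hkm⟩
  obtain ⟨f, hf, hfs⟩ := exists_norming ((φ x - φ p) + (φ x - φ m))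
  have hm1' : ‖(φ x - φ p) + (φ x - φ m)‖ = 2 := hm1
  have f1 := (hf _).trans (hle x p)
  have f2 := (hf _).trans (hle x m)
  rw [hm1', map_add] at hfs
  have f1' : f (φ x - φ p) = 1 := by linarith
  have f2' : f (φ x - φ m) = 1 := by linarith
  have nab : φ x - φ p ≠ φ x - φ m := fun he =>
    h.ne p m hpm (by linarith [hm.2, hq.2, hp.1]) (sub_right_injective he)
  have nbd : φ x - φ m ≠ φ k - φ m := fun he =>
    h.ne x k hxk (by linarith [hp.1, hp.2]) (sub_left_injective he)
  obtain ⟨g1, g2⟩ := functional_eq_one_of_chain hang f nab nbd (hle x p) (hle x m) (hle y m)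
    (hle k m) (hle k q) hm1 hy1 hy2 hm2 f1' f2'
  refine ⟨q, hq, hqS, hone hf ?_, hkq⟩
  rw [map_sub] at f2' g1 g2
  linarith

/-- The points of an arc disjoint from `S` are all at unit distance from one point of `S`. -/
theorem FrontierParam.exists_center {E : Type*} [NormedAddCommGroup E]
    [NormedSpace ℝ E] (hdim : Module.finrank ℝ E = 2) (hang : ¬ Angled E) {C S : Set E} {T : ℝ}
    {φ : ℝ → E} (h : FrontierParam C T φ) (hC : Convex ℝ C) (hcpt : IsCompact C)
    (hint : (interior C).Nonempty) (hd : ∀ x ∈ C, ∀ y ∈ C, ‖x - y‖ ≤ 1) (hS : IsCompact S)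
    {α β : ℝ} (hopp : ∀ t, ∃ s ∈ Icc β (α + T), φ s ∈ S ∧ ‖φ t - φ s‖ = 1) :
    ∃ p ∈ S, ∀ t ∈ Ioo α β, ‖φ t - p‖ = 1 := by
  obtain ⟨p, hpS, hp⟩ := hS.inter_iInter_nonempty (ι := Ioo α β)
    (fun t => {p | ‖φ t - p‖ = 1}) (fun t => isClosed_eq (by fun_prop) continuous_const) (by
      intro u
      rcases u.eq_empty_or_nonempty with rfl | hu
      · obtain ⟨s, -, hs, -⟩ := hopp 0
        exact ⟨φ s, by simpa using hs⟩
      have hmin : (u.min' hu) ≤ (u.max' hu) := u.min'_le_max' hu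
      have hb : ∀ t ∈ u, u.min' hu ≤ t ∧ t ≤ u.max' hu := fun t ht =>
        ⟨u.min'_le t ht, u.le_max' t ht⟩
      generalize u.min' hu = x at hmin hb
      generalize u.max' hu = z at hmin hb
      rcases hmin.eq_or_lt with rfl | hlt
      · obtain ⟨s, -, hs, hs1⟩ := hopp x
        refine ⟨φ s, hs, mem_iInter₂.2 fun t ht => ?_⟩
        have : t = x := le_antisymm (hb t ht).2 (hb t ht).1
        rw [this]
        exact hs1
      · obtain ⟨r, hr, hrS, h1, h2⟩ := h.exists_common_center hdim hang hC hcpt hint hd hopp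
          x.2.1 hlt z.2.2
        refine ⟨φ r, hrS, mem_iInter₂.2 fun t ht => ?_⟩
        rcases (hb t ht).1.eq_or_lt with rfl | hxt
        · exact h1
        rcases (hb t ht).2.eq_or_lt with rfl | htz
        · exact h2
        exact h.norm_sub_eq_one_of_between hdim hC hcpt hint hd hopp x.2.1 hxt htz z.2.2 hr h1 h2)
  exact ⟨p, hpS, fun t ht => mem_iInter.1 hp ⟨t, ht⟩⟩

/-- An arc of the frontier, parametrized by an open interval, is
relatively open in the frontier. -/
theorem FrontierParam.exists_isOpen_image_Ioo {E : Type*} [TopologicalSpace E] [T2Space E]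
    {C : Set E} {T : ℝ} {φ : ℝ → E} (h : FrontierParam C T φ) {α β : ℝ} (hT : 0 < T) :
    ∃ U : Set E, IsOpen U ∧ φ '' Ioo α β = U ∩ frontier C := by
  refine ⟨(φ '' Icc β (α + T))ᶜ, (isCompact_Icc.image h.continuous).isClosed.isOpen_compl, ?_⟩
  ext z
  constructor
  · rintro ⟨t, ht, rfl⟩
    refine ⟨?_, h.mem_frontier t⟩
    rintro ⟨s, hs, hst⟩
    exact h.ne t s (ht.2.trans_le hs.1) (by linarith [ht.1, hs.2]) hst.symm
  · rintro ⟨hz, hzC⟩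
    obtain ⟨t, ht, rfl⟩ := h.exists_mem_Ioc hT α hzC
    refine ⟨t, ⟨ht.1, not_le.1 fun hle => hz ⟨t, ⟨hle, ht.2⟩, rfl⟩⟩, rfl⟩

/-- A point of the line outside a nonempty periodic closed set lies in a bounded
complementary interval. -/
theorem exists_complementary_interval {Z : Set ℝ} (hZ : IsClosed Z) (hne : Z.Nonempty) {T : ℝ}
    (hT : 0 < T) (hper : ∀ t, t + T ∈ Z ↔ t ∈ Z) {τ : ℝ} (hτ : τ ∉ Z) :
    ∃ α ∈ Z, ∃ β ∈ Z, τ ∈ Ioo α β ∧ ∀ t ∈ Ioo α β, t ∉ Z := by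
  have hpred : ∀ z, (z + T ∈ Z) = (z ∈ Z) := fun z => propext (hper z)
  have hp : Function.Periodic (· ∈ Z) T := hpred
  obtain ⟨z, hz⟩ := hne
  obtain ⟨l, hl, hlZ⟩ := hp.exists_mem_Ioc hT z (τ - T)
  have hl' : l ∈ Z := hlZ ▸ hz
  have hA : (Z ∩ Iic τ).Nonempty := ⟨l, hl', by simpa using hl.2⟩
  have hB : (Z ∩ Ici τ).Nonempty := ⟨l + T, (hper l).2 hl', by simpa using (by linarith [hl.1])⟩
  have hAb : BddAbove (Z ∩ Iic τ) := ⟨τ, fun t ht => ht.2⟩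
  have hBb : BddBelow (Z ∩ Ici τ) := ⟨τ, fun t ht => ht.2⟩
  have hα := (hZ.inter isClosed_Iic).csSup_mem hA hAb
  have hβ := (hZ.inter isClosed_Ici).csInf_mem hB hBb
  have hατ : sSup (Z ∩ Iic τ) < τ :=
    lt_of_le_of_ne hα.2 fun he => hτ (he ▸ hα.1)
  have hτβ : τ < sInf (Z ∩ Ici τ) :=
    lt_of_le_of_ne hβ.2 fun he => hτ (he.symm ▸ hβ.1)
  refine ⟨_, hα.1, _, hβ.1, ⟨hατ, hτβ⟩, fun t ht htZ => ?_⟩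
  rcases le_total t τ with h' | h'
  · exact absurd (le_csSup hAb ⟨htZ, h'⟩) (not_le.2 ht.1)
  · exact absurd (csInf_le hBb ⟨htZ, h'⟩) (not_le.2 ht.2)

/-- A set with pairwise distances at most one that attains the diameter one is contained in a
complete set of diameter one. -/
theorem exists_isDiamComplete_superset {X : Type*} [MetricSpace X] {S : Set X}
    (hS : ∀ x ∈ S, ∀ y ∈ S, dist x y ≤ 1) {a b : X} (ha : a ∈ S) (hb : b ∈ S)
    (hab : dist a b = 1) : ∃ D, IsDiamComplete D ∧ S ⊆ D ∧ Metric.diam D = 1 := by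
  obtain ⟨D, hSD, hD⟩ := zorn_subset_nonempty {D : Set X | ∀ x ∈ D, ∀ y ∈ D, dist x y ≤ 1}
    (by
      intro c hc hchain hne
      refine ⟨⋃₀ c, ?_, fun s hs => subset_sUnion_of_mem hs⟩
      rintro x ⟨s, hs, hxs⟩ y ⟨t, ht, hyt⟩
      rcases hchain.total hs ht with h | h
      · exact hc ht x (h hxs) y hyt
      · exact hc hs x hxs y (h hyt)) S hS
  have hdist : ∀ x ∈ D, ∀ y ∈ D, dist x y ≤ 1 := hD.prop
  have hbd : Bornology.IsBounded D := Metric.isBounded_iff.2 ⟨1, fun x hx y hy => hdist x hx y hy⟩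
  have hdiam : Metric.diam D = 1 := le_antisymm
    (Metric.diam_le_of_forall_dist_le zero_le_one hdist)
    (hab ▸ Metric.dist_le_diam_of_mem hbd (hSD ha) (hSD hb))
  refine ⟨D, ?_, hSD, hdiam⟩
  rintro ⟨T, hDT, hT⟩
  rw [hdiam] at hT
  have hTb : Bornology.IsBounded T := by
    by_contra hub
    rw [Metric.diam_eq_zero_of_unbounded hub] at hT
    exact zero_ne_one hT
  have hTm : ∀ x ∈ T, ∀ y ∈ T, dist x y ≤ 1 := fun x hx y hy =>
    hT ▸ Metric.dist_le_diam_of_mem hTb hx hy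
  exact hDT.2 (hD.le_of_ge hTm hDT.1)

/-- A point at distance less than one from every point of the compact set `S` is interior to the
intersection of the unit balls centered in `S`. -/
theorem mem_interior_iInter_closedBall {X : Type*} [PseudoMetricSpace X] {S : Set X}
    (hS : IsCompact S) (hne : S.Nonempty) {x : X} (hx : ∀ p ∈ S, dist x p < 1) :
    x ∈ interior {y | ∀ p ∈ S, dist y p ≤ 1} := by
  obtain ⟨q, hq, hmax⟩ := hS.exists_isMaxOn hne (f := fun p => dist x p)
    (by fun_prop)
  rw [mem_interior_iff_mem_nhds, Metric.mem_nhds_iff]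
  refine ⟨1 - dist x q, by linarith [hx q hq], fun y hy p hp => ?_⟩
  have h1 : dist x p ≤ dist x q := hmax hp
  have h2 := dist_triangle y x p
  rw [Metric.mem_ball] at hy
  linarith

theorem interior_iInter_closedBall_nonempty {E : Type*} [NormedAddCommGroup E] [NormedSpace ℝ E]
    (hdim : Module.finrank ℝ E = 2) {S C : Set E} (hS : IsCompact S) (hSC : S ⊆ C)
    (hC : C = {y | ∀ p ∈ S, dist y p ≤ 1}) (hconv : Convex ℝ C) {a b : E} (ha : a ∈ S)
    (hb : b ∈ S) (hab : dist a b = 1) : (interior C).Nonempty := by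
  have : FiniteDimensional ℝ E := FiniteDimensional.of_finrank_pos (by omega)
  by_contra hemp
  rw [hconv.interior_nonempty_iff_affineSpan_eq_top] at hemp
  have hcol : Collinear ℝ C := by
    rw [collinear_iff_finrank_le_one]
    by_contra hgt
    apply hemp
    have htop : vectorSpan ℝ C = ⊤ := by
      apply Submodule.eq_top_of_finrank_eq
      have := Submodule.finrank_le (vectorSpan ℝ C)
      omega
    exact (AffineSubspace.affineSpan_eq_top_iff_vectorSpan_eq_top_of_nonempty ℝ E E
      ⟨a, hSC ha⟩).2 htop
  rw [collinear_iff_of_mem (hSC ha)] at hcol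
  obtain ⟨v, hv⟩ := hcol
  obtain ⟨r, hr⟩ := hv b (hSC hb)
  simp only [vadd_eq_add] at hr hv
  have hm : (1 / 2 : ℝ) • (a + b) ∈ interior C := by
    rw [hC]
    refine mem_interior_iInter_closedBall hS ⟨a, ha⟩ fun p hp => ?_
    obtain ⟨s, hs⟩ := hv p (hSC hp)
    have hbC : b ∈ C := hSC hb
    have haC : a ∈ C := hSC ha
    rw [hC] at hbC haC
    have h1 := haC p hp
    have h2 := hbC p hp
    have hrv : |r| * ‖v‖ = 1 := by
      rw [← Real.norm_eq_abs, ← norm_smul, ← hab, hr, dist_eq_norm, ← norm_neg]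
      congr 1; abel
    have d1 : dist a p = |s| * ‖v‖ := by
      rw [← Real.norm_eq_abs, ← norm_smul, hs, dist_eq_norm, ← norm_neg]
      congr 1; abel
    have d2 : dist b p = |r - s| * ‖v‖ := by
      rw [← Real.norm_eq_abs, ← norm_smul, hs, hr, dist_eq_norm]
      congr 1; module
    have d3 : dist ((1 / 2 : ℝ) • (a + b)) p = |r / 2 - s| * ‖v‖ := by
      rw [← Real.norm_eq_abs, ← norm_smul, hs, hr, dist_eq_norm]
      congr 1; module
    have hv0 : 0 < ‖v‖ := by
      rcases (norm_nonneg v).eq_or_lt with h | h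
      · rw [← h] at hrv; simp at hrv
      · exact h
    rw [d1, ← hrv] at h1
    rw [d2, ← hrv] at h2
    rw [d3, ← hrv]
    have k1 := le_of_mul_le_mul_right h1 hv0
    have k2 := le_of_mul_le_mul_right h2 hv0
    have hr0 : r ≠ 0 := by rintro rfl; simp at hrv
    refine mul_lt_mul_of_pos_right ?_ hv0
    rcases abs_cases s with ⟨_, _⟩ | ⟨_, _⟩ <;> rcases abs_cases r with ⟨_, _⟩ | ⟨_, _⟩ <;>
      rcases abs_cases (r - s) with ⟨_, _⟩ | ⟨_, _⟩ <;>
      rcases abs_cases (r / 2 - s) with ⟨_, _⟩ | ⟨_, _⟩ <;>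
      rcases lt_or_gt_of_ne hr0 with _ | _ <;> linarith
  exact hemp (hconv.interior_nonempty_iff_affineSpan_eq_top.1 ⟨_, hm⟩)

theorem completion_arc {E : Type*} [NormedAddCommGroup E] [NormedSpace ℝ E]
    (hdim : Module.finrank ℝ E = 2) (hang : ¬ Angled E)
    (S C : Set E) (hcpt : IsCompact S) (hSd : Metric.diam S = 1)
    -- C is the unique completion of S
    (hC : IsDiamComplete C) (hSC : S ⊆ C) (hCd : Metric.diam C = 1)
    (huniq : ∀ C' : Set E, IsDiamComplete C' → S ⊆ C' → Metric.diam C' = 1 → C' = C) :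
    ∀ x ∈ frontier C \ S, ∃ p ∈ S, ∃ A : Set E,
      x ∈ A ∧ A ⊆ frontier C ∧ A ⊆ Metric.sphere p 1 ∧ IsConnected A ∧
      (∃ U : Set E, IsOpen U ∧ A = U ∩ frontier C) ∧
      closure A \ A ⊆ S := by
  have hfin : FiniteDimensional ℝ E := FiniteDimensional.of_finrank_pos (by omega)
  have hCb : Bornology.IsBounded C := by
    by_contra hub
    rw [Metric.diam_eq_zero_of_unbounded hub] at hCd
    exact zero_ne_one hCd
  have hCdist : ∀ x ∈ C, ∀ y ∈ C, dist x y ≤ 1 := fun x hx y hy =>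
    hCd ▸ Metric.dist_le_diam_of_mem hCb hx hy
  have hSne : S.Nonempty := by
    rw [nonempty_iff_ne_empty]
    rintro rfl
    simp at hSd
  obtain ⟨a, ha, b, hb, hab⟩ : ∃ a ∈ S, ∃ b ∈ S, dist a b = 1 := by
    obtain ⟨⟨a, b⟩, ⟨ha, hb⟩, hmax⟩ := (hcpt.prod hcpt).exists_isMaxOn (hSne.prod hSne)
      (f := fun z : E × E => dist z.1 z.2) (by fun_prop)
    refine ⟨a, ha, b, hb, le_antisymm (hCdist a (hSC ha) b (hSC hb)) ?_⟩
    rw [← hSd]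
    exact Metric.diam_le_of_forall_dist_le dist_nonneg fun x hx y hy => hmax (mk_mem_prod hx hy)
  have hCeq : C = {y | ∀ p ∈ S, dist y p ≤ 1} := by
    ext y
    refine ⟨fun hy p hp => hCdist y hy p (hSC hp), fun hy => ?_⟩
    obtain ⟨D, hD, hSD, hDd⟩ := exists_isDiamComplete_superset (S := insert y S) (a := a) (b := b)
      (by
        rintro u (rfl | hu) w (rfl | hw)
        · simp
        · exact hy w hw
        · rw [dist_comm]; exact hy u hu
        · exact hCdist u (hSC hu) w (hSC hw))
      (mem_insert_of_mem _ ha) (mem_insert_of_mem _ hb) hab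
    rw [← huniq D hD ((subset_insert y S).trans hSD) hDd]
    exact hSD (mem_insert y S)
  have hCinter : C = ⋂ p ∈ S, Metric.closedBall p 1 := by
    rw [hCeq]; ext y; simp
  have hconv : Convex ℝ C := hCinter ▸ convex_iInter₂ fun p _ => convex_closedBall p 1
  have hclosed : IsClosed C := hCinter ▸ isClosed_biInter fun p _ => Metric.isClosed_closedBall
  have hCcpt : IsCompact C := Metric.isCompact_of_isClosed_isBounded hclosed hCb
  have hint : (interior C).Nonempty :=
    interior_iInter_closedBall_nonempty hdim hcpt hSC hCeq hconv ha hb hab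
  have hd : ∀ x ∈ C, ∀ y ∈ C, ‖x - y‖ ≤ 1 := fun x hx y hy => dist_eq_norm x y ▸ hCdist x hx y hy
  have hopp : ∀ y ∈ frontier C, ∃ p ∈ S, ‖y - p‖ = 1 := by
    intro y hy
    by_contra! hcon
    refine hy.2 ?_
    rw [hCeq]
    refine mem_interior_iInter_closedBall hcpt hSne fun p hp => ?_
    have hyC := hclosed.frontier_subset hy
    rw [dist_eq_norm]
    exact lt_of_le_of_ne (hd y hyC p (hSC hp)) (hcon p hp)
  have hfrontier : ∀ p ∈ S, ∀ y ∈ C, ‖y - p‖ = 1 → p ∈ frontier C := by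
    intro p hp y hy hyp
    refine ⟨subset_closure (hSC hp), fun hpi => ?_⟩
    have hsub : C ⊆ Metric.closedBall y 1 := fun z hz => hCdist z hz y hy
    have := interior_mono hsub hpi
    rw [interior_closedBall y one_ne_zero, Metric.mem_ball, dist_comm, dist_eq_norm, hyp] at this
    exact lt_irrefl _ this
  obtain ⟨φ, hφ⟩ := exists_frontierParam hdim hconv hCb hint
  set T : ℝ := 2 * Real.pi
  have hT : 0 < T := Real.two_pi_pos
  rintro x ⟨hx, hxS⟩
  obtain ⟨τ, -, rfl⟩ := hφ.exists_mem_Ioc hT 0 hx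
  obtain ⟨z, hz, hz1⟩ := hopp _ hx
  obtain ⟨ζ, -, hζ⟩ := hφ.exists_mem_Ioc hT 0 (hfrontier z hz _ (hclosed.frontier_subset hx) hz1)
  obtain ⟨α, hα, β, hβ, hτ, hdisj⟩ := exists_complementary_interval
    (hcpt.isClosed.preimage hφ.continuous) ⟨ζ, by rwa [mem_preimage, hζ]⟩ hT
    (fun t => by rw [mem_preimage, mem_preimage, hφ.periodic]) (τ := τ) hxS
  obtain ⟨p, hpS, hp⟩ := hφ.exists_center hdim hang hconv hCcpt hint hd hcpt (α := α) (β := β) (by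
    intro t
    obtain ⟨p, hp, hpt⟩ := hopp _ (hφ.mem_frontier t)
    obtain ⟨s, hs, rfl⟩ := hφ.exists_mem_Ioc hT α
      (hfrontier p hp _ (hclosed.frontier_subset (hφ.mem_frontier t)) hpt)
    exact ⟨s, ⟨not_lt.1 fun hlt => hdisj s ⟨hs.1, hlt⟩ hp, hs.2⟩, hp, hpt⟩)
  refine ⟨p, hpS, φ '' Ioo α β, mem_image_of_mem _ hτ, ?_, ?_, ?_,
    hφ.exists_isOpen_image_Ioo hT, ?_⟩
  · rintro _ ⟨t, -, rfl⟩
    exact hφ.mem_frontier t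
  · rintro _ ⟨t, ht, rfl⟩
    rw [mem_sphere_iff_norm]
    exact hp t ht
  · exact (isConnected_Ioo (hτ.1.trans hτ.2)).image _ hφ.continuous.continuousOn
  · rintro y ⟨hy, hyA⟩
    have hsub : closure (φ '' Ioo α β) ⊆ φ '' Icc α β :=
      closure_minimal (image_mono Ioo_subset_Icc_self)
        (isCompact_Icc.image hφ.continuous).isClosed
    obtain ⟨t, ht, rfl⟩ := hsub hy
    rcases ht.1.eq_or_lt with rfl | h1
    · exact hα
    rcases ht.2.eq_or_lt with rfl | h2
    · exact hβ
    exact (hyA ⟨t, ⟨h1, h2⟩, rfl⟩).elim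
end

section
/- Let S be a set of unique completion C in a not angled two-dimensional real normed plane. Then a_k(S) = a_k(C) for every positive integer k. -/
open Set

/-- The `k`-fold Borsuk number of a set `S` in a metric space. -/
noncomputable def borsukNum {X : Type*} [MetricSpace X] (S : Set X) (k : ℕ) : ℕ∞ :=
  sInf {n : ℕ∞ | ∃ m : ℕ, n = (m : ℕ∞) ∧ ∃ F : Fin m → Set X,
    (∀ i, F i ⊆ S ∧ Metric.diam (F i) < Metric.diam S) ∧
    ∀ x ∈ S, k ≤ {i : Fin m | x ∈ F i}.ncard}

open Metric

section Geometry

variable {E : Type*} [NormedAddCommGroup E] [NormedSpace ℝ E]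

/-- If a functional of norm at most one takes the value one at two points of the unit ball, then
the segment between them lies on the unit sphere. -/
lemma segment_subset_sphere_of_dual {f : E →L[ℝ] ℝ} (hf : ‖f‖ ≤ 1) {y v : E}
    (hy : ‖y‖ ≤ 1) (hv : ‖v‖ ≤ 1) (hfy : f y = 1) (hfv : f v = 1) :
    segment ℝ y v ⊆ sphere (0 : E) 1 := by
  rintro z ⟨a, b, ha, hb, hab, rfl⟩
  rw [mem_sphere_zero_iff_norm]
  apply le_antisymm
  · calc ‖a • y + b • v‖ ≤ ‖a • y‖ + ‖b • v‖ := norm_add_le _ _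
      _ = a * ‖y‖ + b * ‖v‖ := by
        rw [norm_smul, norm_smul, Real.norm_of_nonneg ha, Real.norm_of_nonneg hb]
      _ ≤ 1 := by nlinarith
  · have h1 : f (a • y + b • v) = 1 := by simp [hfy, hfv, hab]
    have h2 := f.le_opNorm (a • y + b • v)
    rw [h1, norm_one] at h2
    nlinarith [norm_nonneg (a • y + b • v)]

/-- Let `u`, `v`, `x` be points of the unit ball at mutual distance at most one, `u` and `v` unit
vectors, and let `y` be a unit vector in the open cone spanned by `u` and `v` such that `x` lies
on the same side of the line through `y` as `u`. Then `x` has distance at most one from `y`, with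
equality only if `x = 0` or the segment from `y` to `v` lies on the unit sphere. -/
lemma norm_sub_le_one_of_side {u v x y : E} {a b α β : ℝ} (hu : ‖u‖ = 1) (hv : ‖v‖ = 1)
    (huv : ‖u - v‖ ≤ 1) (hx : ‖x‖ ≤ 1) (hxu : ‖x - u‖ ≤ 1) (hxv : ‖x - v‖ ≤ 1) (hy : ‖y‖ = 1)
    (ha : 0 < a) (hb : 0 < b) (hyab : y = a • u + b • v) (hxab : x = α • u + β • v)
    (hside : β * a ≤ α * b) :
    ‖y - x‖ ≤ 1 ∧ (‖y - x‖ = 1 → x = 0 ∨ segment ℝ y v ⊆ sphere (0 : E) 1) := by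
  rcases le_or_gt α 0 with hα | hα
  · have hβ : β ≤ 0 := by
      by_contra! h
      nlinarith [mul_pos h ha, mul_nonneg (neg_nonneg.2 hα) hb.le]
    have h1 : 0 ≤ α := by
      have e : (1 - α - β) • u = (u - x) + (-β) • (u - v) := by rw [hxab]; module
      have h := norm_add_le (u - x) ((-β) • (u - v))
      rw [← e, norm_smul, norm_smul, hu, Real.norm_of_nonneg (by linarith),
        Real.norm_of_nonneg (by linarith), norm_sub_rev u x] at h
      nlinarith
    have h2 : 0 ≤ β := by
      have e : (1 - α - β) • v = (v - x) + (-α) • (v - u) := by rw [hxab]; module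
      have h := norm_add_le (v - x) ((-α) • (v - u))
      rw [← e, norm_smul, norm_smul, hv, Real.norm_of_nonneg (by linarith),
        Real.norm_of_nonneg (by linarith), norm_sub_rev v x, norm_sub_rev v u] at h
      nlinarith
    have hx0 : x = 0 := by
      rw [hxab, le_antisymm hα h1, le_antisymm hβ h2]; simp
    exact ⟨by rw [hx0, sub_zero, hy], fun _ => Or.inl hx0⟩
  · obtain ⟨t, l, ht0, ht1, hl, hlt⟩ :
        ∃ t l : ℝ, 0 ≤ t ∧ t < 1 ∧ 0 < l ∧ l • y = (1 - t) • x + t • v := by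
      have hκ : 0 ≤ (α * b - β * a) / a := div_nonneg (by linarith) ha.le
      set κ := (α * b - β * a) / a with hκdef
      have hκa : κ * a = α * b - β * a := by rw [hκdef]; field_simp
      refine ⟨κ / (1 + κ), α / (a * (1 + κ)), by positivity, ?_, by positivity, ?_⟩
      · rw [div_lt_one (by positivity)]; linarith
      · have h1 : α / (a * (1 + κ)) * a = (1 - κ / (1 + κ)) * α := by field_simp; ring
        have h2 : α / (a * (1 + κ)) * b = (1 - κ / (1 + κ)) * β + κ / (1 + κ) := by
          field_simp; linarith
        rw [hyab, hxab, smul_add, smul_smul, smul_smul, h1, h2]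
        module
    have htl : t ≤ l := by
      have e : v = l • y + (1 - t) • (v - x) := by rw [hlt]; module
      have h := norm_add_le (l • y) ((1 - t) • (v - x))
      rw [← e, norm_smul, norm_smul, hv, hy, Real.norm_of_nonneg hl.le,
        Real.norm_of_nonneg (by linarith), norm_sub_rev v x] at h
      nlinarith
    rcases le_or_gt 1 l with hl1 | hl1
    · have hlt' : ‖y - x‖ < 1 := by
        have e : l • (y - x) = (l - 1) • (-x) + t • (v - x) := by rw [smul_sub, hlt]; module
        have h := norm_add_le ((l - 1) • (-x)) (t • (v - x))
        rw [← e, norm_smul, norm_smul, norm_smul, norm_neg, Real.norm_of_nonneg hl.le,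
          Real.norm_of_nonneg ht0, Real.norm_of_nonneg (by linarith), norm_sub_rev v x] at h
        nlinarith
      exact ⟨hlt'.le, fun h => absurd h hlt'.ne⟩
    · have e : y - x = (1 - l) • y + t • (v - x) := by
        rw [sub_smul, one_smul, hlt]; module
      refine ⟨?_, fun h1 => Or.inr ?_⟩
      · have h := norm_add_le ((1 - l) • y) (t • (v - x))
        rw [← e, norm_smul, norm_smul, hy, Real.norm_of_nonneg ht0,
          Real.norm_of_nonneg (by linarith), norm_sub_rev v x] at h
        nlinarith
      · obtain ⟨f, hf, hfx⟩ := exists_dual_vector'' ℝ (y - x)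
        rw [h1] at hfx
        have hle : ∀ z : E, ‖z‖ ≤ 1 → f z ≤ 1 := fun z hz => by
          have h2 := f.le_opNorm z
          have h3 := le_abs_self (f z)
          rw [Real.norm_eq_abs] at h2
          nlinarith [norm_nonneg z]
        have hfy := hle y hy.le
        have hfv := hle (v - x) (by rwa [norm_sub_rev])
        have hfe : (1 - l) * f y + t * f (v - x) = 1 := by
          rw [e] at hfx
          simpa using hfx
        have htl' : t = l := by nlinarith
        subst htl'
        have hfy1 : f y = 1 := by nlinarith
        have hfv1 : f (v - x) = 1 := by nlinarith
        refine segment_subset_sphere_of_dual hf hy.le hv.le hfy1 ?_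
        have e : v = t • y + (1 - t) • (v - x) := by rw [hlt]; module
        rw [e, map_add, map_smul, map_smul, hfy1, hfv1]
        simp

/-- The two-sided version of `norm_sub_le_one_of_side`. -/
lemma norm_sub_le_one_of_mem_cone {u v x y : E} {a b α β : ℝ} (hu : ‖u‖ = 1) (hv : ‖v‖ = 1)
    (huv : ‖u - v‖ ≤ 1) (hx : ‖x‖ ≤ 1) (hxu : ‖x - u‖ ≤ 1) (hxv : ‖x - v‖ ≤ 1) (hy : ‖y‖ = 1)
    (ha : 0 < a) (hb : 0 < b) (hyab : y = a • u + b • v) (hxab : x = α • u + β • v) :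
    ‖y - x‖ ≤ 1 ∧ (‖y - x‖ = 1 →
      x = 0 ∨ segment ℝ y v ⊆ sphere (0 : E) 1 ∨ segment ℝ y u ⊆ sphere (0 : E) 1) := by
  rcases le_total (β * a) (α * b) with h | h
  · have := norm_sub_le_one_of_side hu hv huv hx hxu hxv hy ha hb hyab hxab h
    tauto
  · have := norm_sub_le_one_of_side hv hu (by rwa [norm_sub_rev]) hx hxv hxu hy hb ha
      (hyab.trans (add_comm _ _)) (hxab.trans (add_comm _ _)) h
    tauto

/-- The set of `y` for which the segment from `y` to `v` lies on the unit sphere is closed. -/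
lemma isClosed_setOf_segment_subset_sphere (v : E) :
    IsClosed {y : E | segment ℝ y v ⊆ sphere (0 : E) 1} := by
  have : {y : E | segment ℝ y v ⊆ sphere (0 : E) 1} =
      ⋂ θ ∈ Icc (0 : ℝ) 1, {y : E | ‖y + θ • (v - y)‖ = 1} := by
    ext y
    simp only [mem_ofPred_eq, mem_iInter, segment_eq_image', image_subset_iff]
    exact forall₂_congr fun θ _ => by simp
  rw [this]
  exact isClosed_biInter fun θ _ => isClosed_eq (by fun_prop) continuous_const

/-- If the plane is not angled and `u` and `v` are independent unit vectors whose joining segment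
leaves the unit sphere, then the arc of the sphere between `u` and `v` contains a point `y` that is
joined neither to `u` nor to `v` by a segment on the sphere. -/
lemma exists_mem_arc_not_segment_subset_sphere (hang : ¬ Angled E) {u v : E} (hu : ‖u‖ = 1)
    (hv : ‖v‖ = 1) (hli : LinearIndependent ℝ ![u, v])
    (hseg : ¬ segment ℝ u v ⊆ sphere (0 : E) 1) :
    ∃ (y : E) (a b : ℝ), 0 < a ∧ 0 < b ∧ y = a • u + b • v ∧ ‖y‖ = 1 ∧
      ¬ segment ℝ y v ⊆ sphere (0 : E) 1 ∧ ¬ segment ℝ y u ⊆ sphere (0 : E) 1 := by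
  rw [LinearIndependent.pair_iff] at hli
  by_contra! hcon
  let w : ℝ → E := fun t => (1 - t) • u + t • v
  have hw : ∀ t, w t ≠ 0 := fun t h => by
    have := hli _ _ h
    linarith [this.1, this.2]
  let y : ℝ → E := fun t => ‖w t‖⁻¹ • w t
  have hyc : Continuous y := by
    have hwc : Continuous w := by fun_prop
    exact (hwc.norm.inv₀ fun t => norm_ne_zero_iff.2 (hw t)).smul hwc
  have hy1 : ∀ t, ‖y t‖ = 1 := fun t => norm_smul_inv_norm (𝕜 := ℝ) (hw t)
  have hyab : ∀ t, y t = (‖w t‖⁻¹ * (1 - t)) • u + (‖w t‖⁻¹ * t) • v := fun t => by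
    simp only [y, w]; module
  have hy0 : y 0 = u := by simp [y, w, hu]
  have hyone : y 1 = v := by simp [y, w, hv]
  have hwpos : ∀ t, 0 < ‖w t‖⁻¹ := fun t => inv_pos.2 (norm_pos_iff.2 (hw t))
  obtain ⟨t, ht, htv, htu⟩ := isPreconnected_closed_iff.1
    (isPreconnected_Icc (a := (0 : ℝ)) (b := 1))
    (y ⁻¹' {y : E | segment ℝ y v ⊆ sphere (0 : E) 1})
    (y ⁻¹' {y : E | segment ℝ y u ⊆ sphere (0 : E) 1})
    ((isClosed_setOf_segment_subset_sphere v).preimage hyc)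
    ((isClosed_setOf_segment_subset_sphere u).preimage hyc)
    (fun t ht => by
      rcases eq_or_lt_of_le ht.1 with h0 | h0
      · right
        simp [← h0, hy0, hu]
      rcases eq_or_lt_of_le ht.2 with h1 | h1
      · left
        simp [h1, hyone, hv]
      by_cases h : segment ℝ (y t) v ⊆ sphere (0 : E) 1
      · exact Or.inl h
      · exact Or.inr (hcon (y t) _ _ (mul_pos (hwpos t) (by linarith)) (mul_pos (hwpos t) h0)
          (hyab t) (hy1 t) h))
    ⟨1, by simp, by simp [hyone, hv]⟩ ⟨0, by simp, by simp [hy0, hu]⟩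
  simp only [mem_preimage, mem_ofPred_eq] at htv htu
  rcases eq_or_lt_of_le ht.1 with h0 | h0
  · rw [← h0, hy0] at htv
    exact hseg htv
  rcases eq_or_lt_of_le ht.2 with h1 | h1
  · rw [h1, hyone, segment_symm] at htu
    exact hseg htu
  refine hang ⟨u, y t, v, fun hcol => hseg ?_,
    union_subset (by rwa [segment_symm]) htv⟩
  obtain ⟨r, hr⟩ := (collinear_iff_of_mem (p₀ := u) (by simp)).1 hcol
  obtain ⟨c₁, hc₁⟩ := hr (y t) (by simp)
  obtain ⟨c₂, hc₂⟩ := hr v (by simp)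
  simp only [vadd_eq_add] at hc₁ hc₂
  rw [hyab] at hc₁
  have h2 : c₂ • (y t) = c₂ • u + c₁ • (v - u) := by
    rw [hyab, hc₁, sub_eq_of_eq_add hc₂]
    module
  rw [hyab] at h2
  have h3 := hli (c₂ * (‖w t‖⁻¹ * (1 - t)) - c₂ + c₁) (c₂ * (‖w t‖⁻¹ * t) - c₁) (by
    rw [← sub_eq_zero] at h2
    rw [← h2]; module)
  have hc₂0 : c₂ ≠ 0 := by
    rintro rfl
    have := hli 1 (-1) (by rw [hc₂]; simp)
    exact one_ne_zero this.1
  have hsum : ‖w t‖⁻¹ = 1 := by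
    have : c₂ * (‖w t‖⁻¹ - 1) = 0 := by linarith [h3.1, h3.2]
    rcases mul_eq_zero.1 this with h | h
    · exact absurd h hc₂0
    · linarith
  have hyw : y t = (1 - t) • u + t • v := by simp [y, w, hsum]
  obtain ⟨f, hf, hfy⟩ := exists_dual_vector'' ℝ (y t)
  rw [hy1] at hfy
  have hle : ∀ z : E, ‖z‖ ≤ 1 → f z ≤ 1 := fun z hz => by
    have h2 := f.le_opNorm z
    have h3 := le_abs_self (f z)
    rw [Real.norm_eq_abs] at h2
    nlinarith [norm_nonneg z]
  have hfu := hle u hu.le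
  have hfv := hle v hv.le
  have hfe : (1 - t) * f u + t * f v = 1 := by
    rw [hyw] at hfy
    simpa using hfy
  exact segment_subset_sphere_of_dual hf hu.le hv.le (by nlinarith) (by nlinarith)

end Geometry

section Completion

variable {X : Type*} [MetricSpace X]

/-- Points of a set of positive diameter have distance at most the diameter. -/
lemma dist_le_diam_of_pos {T : Set X} (hT : 0 < diam T) {x y : X} (hx : x ∈ T) (hy : y ∈ T) :
    dist x y ≤ diam T := by
  have hb : Bornology.IsBounded T := by
    by_contra h
    rw [diam_eq_zero_of_unbounded h] at hT
    exact lt_irrefl _ hT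
  exact dist_le_diam_of_mem hb hx hy

/-- A set whose points have mutual distances at most `d > 0` and whose subset `S` has diameter `d`
is contained in a complete set of diameter `d`. -/
lemma exists_isDiamComplete_superset_s15 {S T : Set X} (hS : 0 < diam S) (hST : S ⊆ T)
    (hT : ∀ x ∈ T, ∀ y ∈ T, dist x y ≤ diam S) :
    ∃ C : Set X, IsDiamComplete C ∧ T ⊆ C ∧ diam C = diam S := by
  obtain ⟨M, hTM, hM⟩ := zorn_subset_nonempty
    {U : Set X | ∀ x ∈ U, ∀ y ∈ U, dist x y ≤ diam S} (fun c hc hchain _ => by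
      refine ⟨⋃₀ c, ?_, fun s hs => subset_sUnion_of_mem hs⟩
      rintro x ⟨A, hA, hxA⟩ y ⟨B, hB, hyB⟩
      rcases hchain.total hA hB with h | h
      · exact hc hB x (h hxA) y hyB
      · exact hc hA x hxA y (h hyB)) T hT
  have hMb : Bornology.IsBounded M := isBounded_iff.2 ⟨diam S, fun x hx y hy => hM.prop x hx y hy⟩
  have hMd : diam M = diam S :=
    le_antisymm (diam_le_of_forall_dist_le hS.le hM.prop) (diam_mono (hST.trans hTM) hMb)
  refine ⟨M, ?_, hTM, hMd⟩
  rintro ⟨U, hMU, hU⟩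
  have hUd : 0 < diam U := by rw [hU, hMd]; exact hS
  refine hMU.2 (hM.le_of_ge (fun x hx y hy => ?_) hMU.1)
  have := dist_le_diam_of_pos hUd hx hy
  rwa [hU, hMd] at this

/-- If `C` is the unique completion of `S`, then it contains every point at distance at most
the diameter from all points of `S`. -/
lemma mem_of_unique_completion {S C : Set X} (hSd : 0 < diam S)
    (huniq : ∀ C' : Set X, IsDiamComplete C' → S ⊆ C' → diam C' = diam S → C' = C)
    {y : X} (hy : ∀ x ∈ S, dist y x ≤ diam S) : y ∈ C := by
  obtain ⟨C', hC', hsub, hd⟩ := exists_isDiamComplete_superset_s15 (T := insert y S) hSd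
    (subset_insert _ _) (by
      rintro x (rfl | hx) z (rfl | hz)
      · simpa using hSd.le
      · exact hy z hz
      · rw [dist_comm]; exact hy x hx
      · exact dist_le_diam_of_pos hSd hx hz)
  rw [← huniq C' hC' ((subset_insert _ _).trans hsub) hd]
  exact hsub (mem_insert _ _)

end Completion

section Extension

variable {X : Type*} [MetricSpace X]

/-- A uniform version of the statement that every point of the compact set `C` is dominated by a
point in the closure of `S`, with respect to being at distance `d` from points of `C`. -/
lemma exists_uniform_dominating {S C : Set X} {d : ℝ} (hC : IsCompact C)
    (hCd : ∀ x ∈ C, ∀ y ∈ C, dist x y ≤ d)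
    (hdom : ∀ c ∈ C, ∃ s ∈ closure S, ∀ x ∈ C, dist x c = d → dist x s = d)
    {ε : ℝ} (hε : 0 < ε) :
    ∃ δ > 0, ∀ c ∈ C, ∃ s ∈ S, ∀ x ∈ C, d - δ < dist x c → d - ε < dist x s := by
  suffices h : ∃ δ > 0, ∀ c ∈ C, c ∈ C → ∃ s ∈ S, ∀ x ∈ C, d - δ < dist x c → d - ε < dist x s by
    obtain ⟨δ, hδ, h⟩ := h
    exact ⟨δ, hδ, fun c hc => h c hc hc⟩
  refine hC.induction_on
    (p := fun A => ∃ δ > 0, ∀ c ∈ A, c ∈ C → ∃ s ∈ S, ∀ x ∈ C, d - δ < dist x c → d - ε < dist x s)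
    ⟨1, one_pos, by simp⟩ ?_ ?_ ?_
  · rintro A B hAB ⟨δ, hδ, h⟩
    exact ⟨δ, hδ, fun c hc => h c (hAB hc)⟩
  · rintro A B ⟨δ, hδ, h⟩ ⟨δ', hδ', h'⟩
    refine ⟨min δ δ', lt_min hδ hδ', ?_⟩
    rintro c (hc | hc) hcC
    · obtain ⟨s, hs, H⟩ := h c hc hcC
      exact ⟨s, hs, fun x hx hxc => H x hx (by linarith [min_le_left δ δ'])⟩
    · obtain ⟨s, hs, H⟩ := h' c hc hcC
      exact ⟨s, hs, fun x hx hxc => H x hx (by linarith [min_le_right δ δ'])⟩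
  · intro c hc
    obtain ⟨s₀, hs₀, hcs₀⟩ := hdom c hc
    obtain ⟨s, hs, hss₀⟩ := Metric.mem_closure_iff.1 hs₀ (ε / 2) (by positivity)
    obtain ⟨δ, hδ, H⟩ : ∃ δ > 0, ∀ x ∈ C, d - δ < dist x c → d - ε / 2 < dist x s₀ := by
      have hK : IsCompact (C ∩ {x | dist x s₀ ≤ d - ε / 2}) :=
        hC.inter_right (isClosed_le (by fun_prop) continuous_const)
      rcases (C ∩ {x | dist x s₀ ≤ d - ε / 2}).eq_empty_or_nonempty with h | h
      · refine ⟨1, one_pos, fun x hx _ => ?_⟩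
        by_contra! hcon
        exact notMem_empty x (h ▸ ⟨hx, hcon⟩)
      · obtain ⟨z, hz, hmax⟩ := hK.exists_isMaxOn h
          (f := fun x => dist x c) (by fun_prop)
        have hzd : dist z c < d := by
          refine lt_of_le_of_ne (hCd z hz.1 c hc) fun heq => ?_
          have h1 := hcs₀ z hz.1 heq
          have h2 : dist z s₀ ≤ d - ε / 2 := hz.2
          linarith
        refine ⟨d - dist z c, by linarith, fun x hx hxc => ?_⟩
        by_contra! hcon
        have h3 : dist x c ≤ dist z c := hmax (show x ∈ C ∩ _ from ⟨hx, hcon⟩)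
        linarith
    refine ⟨ball c (δ / 2), mem_nhdsWithin_of_mem_nhds (ball_mem_nhds c (by positivity)),
      δ / 2, by positivity, fun c' hc' _ => ⟨s, hs, fun x hx hxc' => ?_⟩⟩
    have h1 := dist_triangle_right x c' c
    have h4 := dist_triangle x c c'
    rw [dist_comm c c'] at h4
    rw [mem_ball] at hc'
    have h2 := H x hx (by linarith)
    have h3 := dist_triangle x s s₀
    rw [dist_comm s s₀] at h3
    linarith

/-- Every point of `T` is covered at least `k` times by `m` subsets of `C` whose points have
mutual distances bounded by a constant smaller than `d`. -/
def HasFoldCover (C : Set X) (d : ℝ) (m k : ℕ) (T : Set X) : Prop :=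
  ∃ F : Fin m → Set X, ∃ ε > 0, (∀ i, F i ⊆ C) ∧
    (∀ i, ∀ x ∈ F i, ∀ y ∈ F i, dist x y ≤ d - ε) ∧
    ∀ x ∈ T, k ≤ {i : Fin m | x ∈ F i}.ncard

lemma HasFoldCover.mono {C : Set X} {d : ℝ} {m k : ℕ} {T T' : Set X}
    (h : HasFoldCover C d m k T') (hT : T ⊆ T') : HasFoldCover C d m k T := by
  obtain ⟨F, ε, hε, hF, hFd, hFk⟩ := h
  exact ⟨F, ε, hε, hF, hFd, fun x hx => hFk x (hT hx)⟩

/-- A fold cover extends to a piece of `C` of small diameter. -/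
lemma HasFoldCover.union_inter_ball {S C : Set X} {d : ℝ} (hd : 0 < d) (hC : IsCompact C)
    (hCd : ∀ x ∈ C, ∀ y ∈ C, dist x y ≤ d)
    (hdom : ∀ c ∈ C, ∃ s ∈ closure S, ∀ x ∈ C, dist x c = d → dist x s = d)
    {m k : ℕ} {T : Set X} (hST : S ⊆ T) (h : HasFoldCover C d m k T) (c : X) :
    HasFoldCover C d m k (T ∪ C ∩ ball c (d / 3)) := by
  obtain ⟨F, ε, hε, hF, hFd, hFk⟩ := h
  obtain ⟨δ, hδ, hψ⟩ := exists_uniform_dominating hC hCd hdom hε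
  choose! ψ hψS hψ using hψ
  have hnew : ∀ i, ∀ x ∈ F i, ∀ y ∈ C, ψ y ∈ F i → dist x y ≤ d - δ := by
    intro i x hx y hy hyi
    by_contra! hcon
    have h1 := hψ y hy x (hF i hx) hcon
    have h2 := hFd i x hx _ hyi
    linarith
  refine ⟨fun i => F i ∪ {y | y ∈ C ∩ ball c (d / 3) ∧ ψ y ∈ F i}, min ε (min δ (d / 3)),
    by positivity, fun i => union_subset (hF i) fun y hy => hy.1.1, ?_, ?_⟩
  · have m1 := min_le_left ε (min δ (d / 3))
    have m2 := (min_le_right ε (min δ (d / 3))).trans (min_le_left _ _)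
    have m3 := (min_le_right ε (min δ (d / 3))).trans (min_le_right _ _)
    rintro i x (hx | hx) y (hy | hy)
    · linarith [hFd i x hx y hy]
    · linarith [hnew i x hx y hy.1.1 hy.2]
    · rw [dist_comm]
      linarith [hnew i y hy x hx.1.1 hx.2]
    · have h1 := dist_triangle_right x y c
      have h2 := mem_ball.1 hx.1.2
      have h3 := mem_ball.1 hy.1.2
      linarith
  · rintro x (hx | hx)
    · exact (hFk x hx).trans (ncard_le_ncard (fun i hi => Or.inl hi) (toFinite _))
    · exact (hFk _ (hST (hψS x hx.1))).trans
        (ncard_le_ncard (fun i hi => Or.inr ⟨hx, hi⟩) (toFinite _))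

/-- A fold cover of `S` extends to `C` when every point of the compact set `C` is dominated by a
point in the closure of `S`. -/
lemma HasFoldCover.extend {S C : Set X} {d : ℝ} (hd : 0 < d) (hC : IsCompact C)
    (hCd : ∀ x ∈ C, ∀ y ∈ C, dist x y ≤ d)
    (hdom : ∀ c ∈ C, ∃ s ∈ closure S, ∀ x ∈ C, dist x c = d → dist x s = d)
    {m k : ℕ} (h : HasFoldCover C d m k S) : HasFoldCover C d m k C := by
  have key : ∀ T, S ⊆ T → HasFoldCover C d m k T → HasFoldCover C d m k (T ∪ C ∩ C) := by
    refine hC.induction_on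
      (p := fun A => ∀ T, S ⊆ T → HasFoldCover C d m k T → HasFoldCover C d m k (T ∪ C ∩ A))
      (fun T _ hT => by simpa using hT) ?_ ?_ ?_
    · exact fun A B hAB hB T hST hT => (hB T hST hT).mono (by gcongr)
    · intro A B hA hB T hST hT
      have := hB _ (hST.trans subset_union_left) (hA T hST hT)
      rwa [union_assoc, ← inter_union_distrib_left] at this
    · exact fun c _ => ⟨ball c (d / 3),
        mem_nhdsWithin_of_mem_nhds (ball_mem_nhds c (by positivity)),
        fun T hST hT => hT.union_inter_ball hd hC hCd hdom hST c⟩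
  exact (key S Subset.rfl h).mono (by simp)

end Extension

section Domination

variable {E : Type*} [NormedAddCommGroup E] [NormedSpace ℝ E]

/-- If `C` is the set of points at distance at most `d` from all points of `S`, then every
endpoint of a segment of length `d` in `C` has distance `d` from a point in the closure of `S`. -/
lemma exists_mem_closure_dist_eq {S C : Set E} {d : ℝ} (hd : 0 < d) (hC : IsCompact C)
    (hSC : S ⊆ C) (hCd : ∀ x ∈ C, ∀ y ∈ C, dist x y ≤ d)
    (hCS : ∀ y, (∀ x ∈ S, dist y x ≤ d) → y ∈ C) {z w : E} (hz : z ∈ C) (hw : w ∈ C)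
    (hzw : dist z w = d) : ∃ s ∈ closure S, dist z s = d := by
  have hcl : closure S ⊆ C := closure_minimal hSC hC.isClosed
  have hcpt : IsCompact (closure S) := hC.of_isClosed_subset isClosed_closure hcl
  have hfar : ∀ t : ℝ, 1 < t → ∃ s ∈ S, d < dist (w + t • (z - w)) s := by
    intro t ht
    by_contra! hcon
    have h1 := hCd _ (hCS _ hcon) w hw
    rw [dist_eq_norm, add_sub_cancel_left, norm_smul, ← dist_eq_norm, hzw,
      Real.norm_of_nonneg (by linarith)] at h1
    nlinarith
  have hne : (closure S).Nonempty := by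
    obtain ⟨s, hs, -⟩ := hfar 2 (by norm_num)
    exact ⟨s, subset_closure hs⟩
  obtain ⟨s, hs, hmax⟩ := hcpt.exists_isMaxOn hne (f := fun x => dist z x) (by fun_prop)
  refine ⟨s, hs, le_antisymm (hCd z hz s (hcl hs)) ?_⟩
  by_contra! hlt
  have hpos : 0 < (d - dist z s) / d := div_pos (by linarith) hd
  obtain ⟨s', hs', hfs'⟩ := hfar (1 + (d - dist z s) / d) (by linarith)
  have h1 : dist z s' ≤ dist z s := hmax (subset_closure hs')
  have h2 := dist_triangle (w + (1 + (d - dist z s) / d) • (z - w)) z s'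
  have h3 : dist (w + (1 + (d - dist z s) / d) • (z - w)) z = d - dist z s := by
    have e : w + (1 + (d - dist z s) / d) • (z - w) - z = ((d - dist z s) / d) • (z - w) := by
      module
    rw [dist_eq_norm, e, norm_smul, ← dist_eq_norm, hzw, Real.norm_of_nonneg hpos.le]
    field_simp
  linarith

/-- If the points of `C` at distance `d` from `c` form a convex set, then they all have distance
`d` from a common point in the closure of `S`. -/
lemma exists_dominating_of_convex {S C : Set E} {d : ℝ} (hd : 0 < d) (hC : IsCompact C)
    (hSC : S ⊆ C) (hSne : S.Nonempty) (hCd : ∀ x ∈ C, ∀ y ∈ C, dist x y ≤ d)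
    (hCS : ∀ y, (∀ x ∈ S, dist y x ≤ d) → y ∈ C) {c : E} (hc : c ∈ C)
    (hconv : Convex ℝ {x | x ∈ C ∧ dist x c = d}) :
    ∃ s ∈ closure S, ∀ x ∈ C, dist x c = d → dist x s = d := by
  have hcl : closure S ⊆ C := closure_minimal hSC hC.isClosed
  have hcpt : IsCompact (closure S) := hC.of_isClosed_subset isClosed_closure hcl
  obtain ⟨s, hs, hsD⟩ := hcpt.inter_iInter_nonempty
    (fun p : {x | x ∈ C ∧ dist x c = d} => {s : E | dist (p : E) s = d})
    (fun p => isClosed_eq (by fun_prop) continuous_const) (fun u => by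
      rcases u.eq_empty_or_nonempty with rfl | hu
      · simpa using hSne
      have hcard : (0 : ℝ) < u.card := by exact_mod_cast hu.card_pos
      have hz := hconv.sum_mem (t := u) (w := fun _ => (u.card : ℝ)⁻¹) (z := fun p => (p : E))
        (fun _ _ => by positivity) (by simp [hcard.ne']) (fun p _ => p.2)
      set z := ∑ p ∈ u, (u.card : ℝ)⁻¹ • (p : E) with hzdef
      obtain ⟨s, hs, hzs⟩ := exists_mem_closure_dist_eq hd hC hSC hCd hCS hz.1 hc hz.2
      refine ⟨s, hs, mem_iInter₂.2 fun p hp => ?_⟩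
      have hle : ∀ q ∈ u, dist (q : E) s ≤ d := fun q _ => hCd q q.2.1 s (hcl hs)
      refine (Finset.sum_eq_sum_iff_of_le hle).1 (le_antisymm (Finset.sum_le_sum hle) ?_) p hp
      have e : z - s = ∑ q ∈ u, (u.card : ℝ)⁻¹ • ((q : E) - s) := by
        simp_rw [smul_sub, Finset.sum_sub_distrib, ← hzdef, Finset.sum_const,
          ← Nat.cast_smul_eq_nsmul ℝ, smul_smul, mul_inv_cancel₀ hcard.ne', one_smul]
      have h1 : d ≤ ∑ q ∈ u, (u.card : ℝ)⁻¹ * dist (q : E) s := by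
        refine (hzs.symm.trans (by rw [dist_eq_norm, e])).trans_le ?_
        refine (norm_sum_le _ _).trans_eq (Finset.sum_congr rfl fun q _ => ?_)
        rw [norm_smul, Real.norm_of_nonneg (by positivity), dist_eq_norm]
      rw [← Finset.mul_sum, le_inv_mul_iff₀ hcard] at h1
      simpa using h1)
  exact ⟨s, hs, fun x hx hxc => mem_iInter.1 hsD ⟨x, hx, hxc⟩⟩

/-- In a plane that is not angled, a point `c` of `C` such that the points of `C` at distance `d`
from `c` do not form a convex set belongs to the closure of `S`. -/
lemma mem_closure_of_not_convex (hdim : Module.finrank ℝ E = 2) (hang : ¬ Angled E)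
    {S C : Set E} {d : ℝ} (hd : 0 < d) (hC : IsCompact C)
    (hSC : S ⊆ C) (hCd : ∀ x ∈ C, ∀ y ∈ C, dist x y ≤ d)
    (hCS : ∀ y, (∀ x ∈ S, dist y x ≤ d) → y ∈ C) {c : E} (hc : c ∈ C)
    (hconv : ¬ Convex ℝ {x | x ∈ C ∧ dist x c = d}) : c ∈ closure S := by
  have hcl : closure S ⊆ C := closure_minimal hSC hC.isClosed
  have hCconv : ∀ z, (∀ x ∈ C, dist z x ≤ d) → z ∈ C := fun z hz =>
    hCS z fun x hx => hz x (hSC hx)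
  have hscale : ∀ x y : E, ‖d⁻¹ • (x - c) - d⁻¹ • (y - c)‖ = d⁻¹ * dist x y := fun x y => by
    rw [← smul_sub, norm_smul, Real.norm_of_nonneg (by positivity), sub_sub_sub_cancel_right,
      dist_eq_norm]
  have hscale1 : ∀ x ∈ C, ∀ y ∈ C, ‖d⁻¹ • (x - c) - d⁻¹ • (y - c)‖ ≤ 1 := fun x hx y hy => by
    rw [hscale, inv_mul_le_iff₀ hd, mul_one]
    exact hCd x hx y hy
  have hscale0 : ∀ x : E, ‖d⁻¹ • (x - c)‖ = d⁻¹ * dist x c := fun x => by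
    have := hscale x c
    simpa using this
  simp only [convex_iff_segment_subset, not_forall] at hconv
  obtain ⟨p, ⟨hpC, hpc⟩, q, ⟨hqC, hqc⟩, hpq⟩ := hconv
  set u := d⁻¹ • (p - c) with hudef
  set v := d⁻¹ • (q - c) with hvdef
  have hu : ‖u‖ = 1 := by rw [hscale0, hpc, inv_mul_cancel₀ hd.ne']
  have hv : ‖v‖ = 1 := by rw [hscale0, hqc, inv_mul_cancel₀ hd.ne']
  have huv : ‖u - v‖ ≤ 1 := hscale1 p hpC q hqC
  have hseg : ¬ segment ℝ u v ⊆ sphere (0 : E) 1 := by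
    intro h
    refine hpq ?_
    rintro _ ⟨a, b, ha, hb, hab, rfl⟩
    refine ⟨hCconv _ fun x hx => ?_, ?_⟩
    · have e : a • p + b • q - x = a • (p - x) + b • (q - x) := by
        have : x = (a + b) • x := by rw [hab, one_smul]
        nth_rw 1 [this]
        module
      have h1 := norm_add_le (a • (p - x)) (b • (q - x))
      rw [← e, norm_smul, norm_smul, Real.norm_of_nonneg ha, Real.norm_of_nonneg hb,
        ← dist_eq_norm, ← dist_eq_norm, ← dist_eq_norm] at h1
      nlinarith [hCd p hpC x hx, hCd q hqC x hx]
    · have h1 : a • u + b • v ∈ sphere (0 : E) 1 := h ⟨a, b, ha, hb, hab, rfl⟩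
      have e : a • u + b • v = d⁻¹ • (a • p + b • q - c) := by
        have : c = (a + b) • c := by rw [hab, one_smul]
        rw [hudef, hvdef]
        nth_rw 3 [this]
        module
      rw [mem_sphere_zero_iff_norm, e, hscale0, inv_mul_eq_one₀ hd.ne'] at h1
      exact h1.symm
  have hli : LinearIndependent ℝ ![u, v] := by
    have hu0 : u ≠ 0 := by rintro h; simp [h] at hu
    rw [LinearIndependent.pair_iff' hu0]
    intro a hav
    have h1 : |a| = 1 := by
      have := hv
      rwa [← hav, norm_smul, hu, mul_one, Real.norm_eq_abs] at this
    rcases eq_or_eq_neg_of_abs_eq h1 with rfl | rfl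
    · rw [one_smul] at hav
      exact hseg (by simp [← hav, hu])
    · rw [← hav] at huv
      have e : u - (-1 : ℝ) • u = (2 : ℝ) • u := by module
      rw [e, norm_smul, hu] at huv
      norm_num at huv
  obtain ⟨y, a, b, ha, hb, hyab, hy, hyv, hyu⟩ :=
    exists_mem_arc_not_segment_subset_sphere hang hu hv hli hseg
  have hspan : ∀ x : E, ∃ α β : ℝ, x = α • u + β • v := fun x => by
    have htop := hli.span_eq_top_of_card_eq_finrank (by simp [hdim])
    have hx : x ∈ Submodule.span ℝ (range ![u, v]) := htop ▸ Submodule.mem_top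
    rw [Matrix.range_cons, Matrix.range_cons, Matrix.range_empty, union_empty,
      singleton_union, Submodule.mem_span_pair] at hx
    obtain ⟨α, β, h⟩ := hx
    exact ⟨α, β, h.symm⟩
  have hz : d⁻¹ • (c + d • y - c) = y := by
    rw [add_sub_cancel_left, inv_smul_smul₀ hd.ne']
  have hmain : ∀ x ∈ C, dist (c + d • y) x ≤ d ∧ (dist (c + d • y) x = d → x = c) := by
    intro x hx
    obtain ⟨α, β, hx'⟩ := hspan (d⁻¹ • (x - c))
    have h := norm_sub_le_one_of_mem_cone hu hv huv (by simpa using hscale1 x hx c hc)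
      (hscale1 x hx p hpC) (hscale1 x hx q hqC) hy ha hb hyab hx'
    rw [← hz, hscale, hz, inv_mul_le_iff₀ hd, mul_one, inv_mul_eq_one₀ hd.ne'] at h
    refine ⟨h.1, fun heq => ?_⟩
    rcases h.2 heq.symm with h0 | h0 | h0
    · rw [smul_eq_zero_iff_right (inv_ne_zero hd.ne'), sub_eq_zero] at h0
      exact h0
    · exact absurd h0 hyv
    · exact absurd h0 hyu
  have hzc : dist (c + d • y) c = d := by
    rw [dist_eq_norm, add_sub_cancel_left, norm_smul, hy, mul_one, Real.norm_of_nonneg hd.le]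
  obtain ⟨s, hs, hzs⟩ := exists_mem_closure_dist_eq hd hC hSC hCd hCS
    (hCconv _ fun x hx => (hmain x hx).1) hc hzc
  rwa [(hmain s (hcl hs)).2 hzs] at hs

end Domination

theorem borsuk_eq_of_unique_completion {E : Type*} [NormedAddCommGroup E]
    [NormedSpace ℝ E]
    (hdim : Module.finrank ℝ E = 2) (hang : ¬ Angled E)
    (S C : Set E) (hSd : 0 < Metric.diam S)
    -- C is the unique completion of S
    (hC : IsDiamComplete C) (hSC : S ⊆ C) (hCd : Metric.diam C = Metric.diam S)
    (huniq : ∀ C' : Set E, IsDiamComplete C' → S ⊆ C' →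
      Metric.diam C' = Metric.diam S → C' = C)
    (k : ℕ) (hk : 0 < k) :
    borsukNum S k = borsukNum C k := by
  have hfin : FiniteDimensional ℝ E := Module.finite_of_finrank_eq_succ hdim
  have hproper : ProperSpace E := FiniteDimensional.proper_real E
  have hCpos : 0 < diam C := hCd ▸ hSd
  have hCdist : ∀ x ∈ C, ∀ y ∈ C, dist x y ≤ diam S := fun x hx y hy =>
    hCd ▸ dist_le_diam_of_pos hCpos hx hy
  have hCS : ∀ y, (∀ x ∈ S, dist y x ≤ diam S) → y ∈ C := fun y hy =>
    mem_of_unique_completion hSd huniq hy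
  have hSne : S.Nonempty := by
    rw [nonempty_iff_ne_empty]
    rintro rfl
    simp at hSd
  have hCeq : C = ⋂ x ∈ S, {y | dist y x ≤ diam S} := by
    ext y
    simp only [mem_iInter, mem_ofPred_eq]
    exact ⟨fun hy x hx => hCdist y hy x (hSC hx), hCS y⟩
  have hCclosed : IsClosed C := by
    rw [hCeq]
    exact isClosed_biInter fun x _ => isClosed_le (by fun_prop) continuous_const
  have hCcpt : IsCompact C :=
    isCompact_of_isClosed_isBounded hCclosed
      (isBounded_iff.2 ⟨diam S, fun x hx y hy => hCdist x hx y hy⟩)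
  have hdom : ∀ c ∈ C, ∃ s ∈ closure S, ∀ x ∈ C, dist x c = diam S → dist x s = diam S := by
    intro c hc
    by_cases hconv : Convex ℝ {x | x ∈ C ∧ dist x c = diam S}
    · exact exists_dominating_of_convex hSd hCcpt hSC hSne hCdist hCS hc hconv
    · exact ⟨c, mem_closure_of_not_convex hdim hang hSd hCcpt hSC hCdist hCS hc hconv,
        fun _ _ h => h⟩
  have hiff : ∀ m : ℕ,
      (∃ F : Fin m → Set E, (∀ i, F i ⊆ S ∧ diam (F i) < diam S) ∧
        ∀ x ∈ S, k ≤ {i : Fin m | x ∈ F i}.ncard) ↔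
      (∃ F : Fin m → Set E, (∀ i, F i ⊆ C ∧ diam (F i) < diam C) ∧
        ∀ x ∈ C, k ≤ {i : Fin m | x ∈ F i}.ncard) := by
    intro m
    constructor
    · rintro ⟨F, hF, hFk⟩
      have hcov : HasFoldCover C (diam S) m k S := by
        obtain ⟨ε, hε, hFε⟩ : ∃ ε > 0, ∀ i, ε ≤ diam S - diam (F i) := by
          rcases isEmpty_or_nonempty (Fin m) with h | h
          · exact ⟨1, one_pos, fun i => h.elim i⟩
          · obtain ⟨j, hj⟩ := Finite.exists_min fun i => diam S - diam (F i)
            exact ⟨_, sub_pos.2 (hF j).2, hj⟩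
        refine ⟨F, ε, hε, fun i => (hF i).1.trans hSC, fun i x hx y hy => ?_, hFk⟩
        have hb : Bornology.IsBounded (F i) := hCcpt.isBounded.subset ((hF i).1.trans hSC)
        linarith [dist_le_diam_of_mem hb hx hy, hFε i]
      obtain ⟨G, ε, hε, hG, hGd, hGk⟩ := hcov.extend hSd hCcpt hCdist hdom
      refine ⟨G, fun i => ⟨hG i, ?_⟩, hGk⟩
      rw [hCd]
      refine (diam_le_of_forall_dist_le (le_max_right (diam S - ε) 0)
        fun x hx y hy => (hGd i x hx y hy).trans (le_max_left _ _)).trans_lt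
        (max_lt (by linarith) hSd)
    · rintro ⟨F, hF, hFk⟩
      refine ⟨fun i => F i ∩ S, fun i => ⟨inter_subset_right, ?_⟩, fun x hx => ?_⟩
      · rw [← hCd]
        exact (diam_mono inter_subset_left
          (hCcpt.isBounded.subset (hF i).1)).trans_lt (hF i).2
      · exact (hFk x (hSC hx)).trans (ncard_le_ncard (fun i hi => ⟨hi, hx⟩) (toFinite _))
  simp only [borsukNum, hiff]
end

section
/- Let C be a complete set of diameter 1 in a two-dimensional real normed plane that is not a Reuleaux polygon (i.e., C is not the intersection of finitely many translates of the unit ball). Then a_k(C) = 2k + 1 for every positive integer k. -/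
open Set

theorem exists_lin_ker_span {E : Type*} [NormedAddCommGroup E] [NormedSpace ℝ E]
    (hdim : Module.finrank ℝ E = 2) {d : E} (hd : d ≠ 0) :
    ∃ f : E →L[ℝ] ℝ, ∀ v, f v = 0 ↔ ∃ s : ℝ, v = s • d := by
  have : FiniteDimensional ℝ E := FiniteDimensional.of_finrank_pos (by omega)
  have h1 : Module.finrank ℝ (Submodule.span ℝ {d}) = 1 := finrank_span_singleton hd
  have hlt : Submodule.span ℝ {d} < ⊤ := by
    rw [lt_top_iff_ne_top]
    intro h
    rw [h, finrank_top] at h1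
    omega
  obtain ⟨f, hf0, hf⟩ := Submodule.exists_le_ker_of_lt_top _ hlt
  have hr : LinearMap.range f = ⊤ := LinearMap.range_eq_top.2 (LinearMap.surjective hf0)
  have h2 := LinearMap.finrank_range_add_finrank_ker f
  rw [hr, finrank_top, Module.finrank_self, hdim] at h2
  have h3 : Submodule.span ℝ {d} = LinearMap.ker f :=
    Submodule.eq_of_le_of_finrank_eq hf (by omega)
  refine ⟨LinearMap.toContinuousLinearMap f, fun v => ?_⟩
  rw [LinearMap.coe_toContinuousLinearMap', ← LinearMap.mem_ker, ← h3,
    Submodule.mem_span_singleton]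
  simp only [eq_comm]

/-- If two diametral chords `[x, y]`, `[a, b]` of a set of diameter one are such that neither
`a` nor `b` has distance one from `x`, then `a` and `b` are strictly separated by the line
through `x` and `y`. -/
theorem mul_neg_of_diametral {E : Type*} [NormedAddCommGroup E] [NormedSpace ℝ E]
    {x y a b : E} {f : E →L[ℝ] ℝ} (hf : ∀ v, f v = 0 ↔ ∃ s : ℝ, v = s • (x - y))
    (hxy : ‖x - y‖ = 1) (hab : ‖a - b‖ = 1) (hay : ‖a - y‖ ≤ 1) (hby : ‖b - y‖ ≤ 1)
    (hax : ‖a - x‖ < 1) (hbx : ‖b - x‖ < 1) : f (a - x) * f (b - x) < 0 := by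
  -- a point of the chord's line with a diametral partner
  have online : ∀ a b : E, ‖a - b‖ = 1 → ‖a - y‖ ≤ 1 → ‖b - y‖ ≤ 1 → ‖a - x‖ < 1 →
      ‖b - x‖ < 1 → f (a - x) ≠ 0 := by
    intro a b hab hay hby hax hbx h0
    obtain ⟨s, hs⟩ := (hf _).1 h0
    have e1 : a - y = (1 + s) • (x - y) := by
      linear_combination (norm := module) hs
    have n1 : |s| < 1 := by rw [hs, norm_smul, hxy] at hax; simpa using hax
    have n2 : |1 + s| ≤ 1 := by rw [e1, norm_smul, hxy] at hay; simpa using hay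
    have hs0 : s ≤ 0 := by linarith [(abs_le.1 n2).2]
    have hs1 : 0 < 1 + s := by linarith [(abs_lt.1 n1).1]
    have e2 : a - b = (1 + s) • (x - b) + (-s) • (y - b) := by
      linear_combination (norm := module) hs
    have n3 : ‖a - b‖ ≤ (1 + s) * ‖b - x‖ + (-s) * ‖b - y‖ := by
      rw [e2]
      refine (norm_add_le _ _).trans (le_of_eq ?_)
      rw [norm_smul, norm_smul, norm_sub_rev x b, norm_sub_rev y b, Real.norm_of_nonneg hs1.le,
        Real.norm_of_nonneg (by linarith)]
    nlinarith
  have ha0 := online a b hab hay hby hax hbx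
  have hb0 := online b a (by rwa [norm_sub_rev]) hby hay hbx hax
  -- both endpoints on the same side is impossible
  have key : ∀ g : E →L[ℝ] ℝ, (∀ v, g v = 0 ↔ ∃ s : ℝ, v = s • (x - y)) →
      0 < g (a - x) → 0 < g (b - x) → False := by
    intro g hg hα hβ
    obtain ⟨s, hs⟩ := (hg (g (b - x) • (a - x) - g (a - x) • (b - x))).1 (by
      simp only [map_sub, map_smul, smul_eq_mul]; ring)
    generalize g (a - x) = α at *
    generalize g (b - x) = β at *
    have norm2 : ∀ (p q : ℝ) (v w z : E) (c : ℝ), 0 ≤ c → 0 ≤ p → 0 ≤ q →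
        c • z = p • v + q • w → c * ‖z‖ ≤ p * ‖v‖ + q * ‖w‖ := by
      intro p q v w z c hc hp hq h
      have := norm_add_le (p • v) (q • w)
      rwa [← h, norm_smul, norm_smul, norm_smul, Real.norm_of_nonneg hp,
        Real.norm_of_nonneg hq, Real.norm_of_nonneg hc] at this
    have hbx' : ‖x - b‖ < 1 := by rwa [norm_sub_rev]
    rcases le_total 0 s with h1 | h1 <;> rcases le_total 0 (β - α + s) with h2 | h2
    · have m1 := norm2 s (β - α + s) (a - y) (x - b) (a - b) (β + s) (by linarith) h1 h2 (by
        linear_combination (norm := module) hs)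
      have m2 := norm2 α β (x - b) (a - y) (x - y) (β + s) (by linarith) hα.le hβ.le (by
        linear_combination (norm := module) (-1:ℝ) • hs)
      rw [hab] at m1
      rw [hxy] at m2
      nlinarith
    · have m1 := norm2 s (α - β - s) (a - y) (a - x) (a - b) α hα.le h1 (by linarith) (by
        linear_combination (norm := module) hs)
      rw [hab] at m1
      nlinarith
    · have m1 := norm2 (-s) (β - α + s) (b - y) (b - x) (b - a) β hβ.le (by linarith) h2 (by
        linear_combination (norm := module) (-1:ℝ) • hs)
      rw [norm_sub_rev, hab] at m1
      nlinarith
    · have hyb : ‖y - b‖ ≤ 1 := by rwa [norm_sub_rev]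
      have m1 := norm2 (α - β - s) (-s) (a - x) (y - b) (a - b) (α - s) (by linarith)
        (by linarith) (by linarith) (by linear_combination (norm := module) hs)
      have m2 := norm2 α β (y - b) (a - x) (y - x) (α - s) (by linarith) hα.le hβ.le (by
        linear_combination (norm := module) (-1:ℝ) • hs)
      rw [hab] at m1
      rw [norm_sub_rev, hxy] at m2
      nlinarith
  rcases lt_or_gt_of_ne ha0 with h1 | h1 <;> rcases lt_or_gt_of_ne hb0 with h2 | h2
  · exact (key (-f) (fun v => by simpa using hf v) (by simpa using h1) (by simpa using h2)).elim
  · exact mul_neg_of_neg_of_pos h1 h2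
  · exact mul_neg_of_pos_of_neg h1 h2
  · exact (key f hf h1 h2).elim

theorem exists_odd_cycle_coloring {V : Type*} (G : SimpleGraph V) (X : Set V) (σ : V → Prop)
    {k : ℕ} (hk : 0 < k)
    (hσ : ∀ a b, G.Adj a b → a ∉ X → b ∉ X → (σ a ↔ ¬ σ b))
    (hodd : ∀ j < k, ∀ x ∈ X, ∀ y ∈ X, ∀ p : G.Walk x y, p.length ≠ 2 * j + 1) :
    ∃ c : V → ℤ, ∀ a b, G.Adj a b →
      (2 * k + 1 : ℤ) ∣ c a - c b - 1 ∨ (2 * k + 1 : ℤ) ∣ c b - c a - 1 := by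
  classical
  let S : V → Set ℕ := fun v => {j | j = k ∨ ∃ x ∈ X, ∃ p : G.Walk x v, p.length = j}
  let r : V → ℕ := fun v => sInf (S v)
  have hr : ∀ v, r v ∈ S v := fun v => Nat.sInf_mem ⟨k, Or.inl rfl⟩
  have hrk : ∀ v, r v ≤ k := fun v => Nat.sInf_le (Or.inl rfl)
  have hrX : ∀ v, r v = 0 ↔ v ∈ X := by
    intro v
    constructor
    · intro h0
      rcases hr v with h1 | ⟨x, hx, p, hp⟩
      · omega
      · rw [h0] at hp
        rwa [← SimpleGraph.Walk.eq_of_length_eq_zero hp]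
    · intro hv
      exact Nat.le_zero.1 (Nat.sInf_le (Or.inr ⟨v, hv, SimpleGraph.Walk.nil, rfl⟩))
  have hstep : ∀ v w, G.Adj v w → r w ≤ r v + 1 := by
    intro v w hvw
    rcases hr v with h1 | ⟨x, hx, p, hp⟩
    · rw [h1]
      exact (hrk w).trans (Nat.le_succ k)
    · refine Nat.sInf_le (Or.inr ⟨x, hx, p.append (.cons hvw .nil), ?_⟩)
      rw [SimpleGraph.Walk.length_append, hp]
      rfl
  have heq : ∀ v w, G.Adj v w → r v = r w → r v = k := by
    intro v w hvw he
    by_contra hne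
    have hlt : r v < k := lt_of_le_of_ne (hrk v) hne
    rcases hr v with h1 | ⟨x, hx, p, hp⟩
    · exact hne h1
    rcases hr w with h2 | ⟨y, hy, q, hq⟩
    · exact hne (he.trans h2)
    refine hodd (r v) hlt x hx y hy (p.append (.cons hvw q.reverse)) ?_
    rw [SimpleGraph.Walk.length_append, SimpleGraph.Walk.length_cons,
      SimpleGraph.Walk.length_reverse, hp, hq, ← he]
    ring
  refine ⟨fun v => if (σ v ↔ Odd (r v)) then (r v : ℤ) else -(r v : ℤ), ?_⟩
  intro v w hvw
  have h1 := hstep v w hvw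
  have h2 := hstep w v hvw.symm
  have h3 := heq v w hvw
  have h4 := hrk v
  have h5 := hrk w
  have h6 := hrX v
  have h7 := hrX w
  have h8 := hσ v w hvw
  have cong : ∀ m : ℤ, (m = 0 ∨ m = -(2 * k + 1)) → (2 * k + 1 : ℤ) ∣ m := by
    rintro m (rfl | rfl)
    · exact dvd_zero _
    · exact (dvd_refl _).neg_right
  have hcases : r v = r w ∨ r w = r v + 1 ∨ r v = r w + 1 := by omega
  rcases hcases with he | he | he
  · have hk' := h3 he
    have hs := h8 (by rw [← h6]; omega) (by rw [← h7]; omega)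
    rw [he] at hk'
    dsimp only
    rw [he, hk']
    by_cases a : σ v <;> by_cases b : σ w <;> by_cases d : Odd k <;>
      simp only [a, b, d, iff_true, iff_false, not_true, not_false_iff, if_true,
        if_false] at hs ⊢ <;>
      first
      | exact Or.inl (cong _ (by omega))
      | exact Or.inr (cong _ (by omega))
  · by_cases hv : v ∈ X
    · have hv0 := h6.2 hv
      have hw1 : r w = 1 := by omega
      dsimp only
      rw [hv0, hw1]
      split_ifs <;> simp
    · have hs := h8 hv (by rw [← h7]; omega)
      dsimp only
      rw [he]
      by_cases a : σ v <;> by_cases b : σ w <;> by_cases d : Odd (r v) <;>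
        simp only [a, b, d, iff_true, iff_false, not_true, not_false_iff, if_true,
          if_false, Nat.odd_add_one] at hs ⊢ <;>
        first
        | exact Or.inl (cong _ (by push_cast; omega))
        | exact Or.inr (cong _ (by push_cast; omega))
  · by_cases hw : w ∈ X
    · have hw0 := h7.2 hw
      have hv1 : r v = 1 := by omega
      dsimp only
      rw [hw0, hv1]
      split_ifs <;> simp
    · have hs := h8 (by rw [← h6]; omega) hw
      dsimp only
      rw [he]
      by_cases a : σ v <;> by_cases b : σ w <;> by_cases d : Odd (r w) <;>
        simp only [a, b, d, iff_true, iff_false, not_true, not_false_iff, if_true,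
          if_false, Nat.odd_add_one] at hs ⊢ <;>
        first
        | exact Or.inl (cong _ (by push_cast; omega))
        | exact Or.inr (cong _ (by push_cast; omega))

/-- The arithmetic progressions `c, c + 2, …, c + 2 (k - 1)` in `ZMod (2 k + 1)`. -/
def stepTwo (k : ℕ) (c : ℤ) : Set (ZMod (2 * k + 1)) :=
  Set.image (fun t : ℕ => ((c + 2 * t : ℤ) : ZMod (2 * k + 1))) (Iio k)

theorem ncard_stepTwo (k : ℕ) (c : ℤ) : (stepTwo k c).ncard = k := by
  rw [stepTwo, InjOn.ncard_image, ← Finset.coe_Iio, ncard_coe_finset, Nat.card_Iio]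
  intro s hs t ht hst
  rw [mem_Iio] at hs ht
  have h := (ZMod.intCast_eq_intCast_iff_dvd_sub _ _ _).1 hst
  have h0 := Int.eq_zero_of_abs_lt_dvd h (by rw [abs_lt]; push_cast; omega)
  omega

theorem disjoint_stepTwo {k : ℕ} {c d : ℤ} (h : (2 * k + 1 : ℤ) ∣ c - d - 1) :
    Disjoint (stepTwo k c) (stepTwo k d) := by
  rw [Set.disjoint_left]
  rintro i ⟨s, hs, rfl⟩ ⟨t, ht, hst⟩
  rw [mem_Iio] at hs ht
  have h1 := (ZMod.intCast_eq_intCast_iff_dvd_sub _ _ _).1 hst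
  push_cast at h1
  have h2 := dvd_sub h1 h
  have h3 := Int.eq_zero_of_abs_lt_dvd h2 (by rw [abs_lt]; omega)
  omega

/-- A set of diameter one in a normed space to which no point can be added without
increasing the diameter. -/
structure IsUnitComplete {E : Type*} [NormedAddCommGroup E] (C : Set E) : Prop where
  nonempty : C.Nonempty
  dist_le : ∀ x ∈ C, ∀ y ∈ C, dist x y ≤ 1
  mem_of_dist_le : ∀ z, (∀ p ∈ C, dist z p ≤ 1) → z ∈ C

namespace IsUnitComplete

variable {E : Type*} [NormedAddCommGroup E] {C : Set E}

theorem of_isDiamComplete (hC : IsDiamComplete C) (hd : Metric.diam C = 1) :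
    IsUnitComplete C := by
  have hb : Bornology.IsBounded C := by
    by_contra h
    rw [Metric.diam_eq_zero_of_unbounded h] at hd
    exact zero_ne_one hd
  have hle : ∀ x ∈ C, ∀ y ∈ C, dist x y ≤ 1 := fun x hx y hy =>
    hd ▸ Metric.dist_le_diam_of_mem hb hx hy
  refine ⟨?_, hle, fun z hz => ?_⟩
  · rw [nonempty_iff_ne_empty]
    rintro rfl
    simp at hd
  · by_contra hzC
    refine hC ⟨insert z C, ssubset_insert hzC, le_antisymm ?_
      (Metric.diam_mono (subset_insert z C) (hb.insert z))⟩
    rw [hd]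
    refine Metric.diam_le_of_forall_dist_le zero_le_one ?_
    rintro x (rfl | hx) y (rfl | hy)
    · simp
    · exact hz y hy
    · exact dist_comm x y ▸ hz x hx
    · exact hle x hx y hy

theorem eq_iInter (h : IsUnitComplete C) : C = ⋂ p ∈ C, Metric.closedBall p 1 := by
  ext z
  simp only [mem_iInter, Metric.mem_closedBall]
  exact ⟨fun hz p hp => h.dist_le z hz p hp, h.mem_of_dist_le z⟩

theorem isClosed (h : IsUnitComplete C) : IsClosed C := by
  rw [h.eq_iInter]
  exact isClosed_biInter fun _ _ => Metric.isClosed_closedBall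

theorem isBounded (h : IsUnitComplete C) : Bornology.IsBounded C :=
  Metric.isBounded_iff.2 ⟨1, fun x hx y hy => h.dist_le x hx y hy⟩

theorem isCompact [ProperSpace E] (h : IsUnitComplete C) : IsCompact C :=
  Metric.isCompact_of_isClosed_isBounded h.isClosed h.isBounded

theorem mem_interior_of_dist_ne_one [ProperSpace E] (h : IsUnitComplete C)
    {x : E} (hx : ∀ p ∈ C, dist x p ≠ 1) (hxC : x ∈ C) : x ∈ interior C := by
  obtain ⟨q, hq, hmax⟩ := h.isCompact.exists_isMaxOn h.nonempty
    (f := fun p => dist x p) (by fun_prop)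
  have hlt : dist x q < 1 := lt_of_le_of_ne (h.dist_le x hxC q hq) (hx q hq)
  refine mem_interior.2 ⟨Metric.ball x (1 - dist x q), fun z hz => h.mem_of_dist_le z ?_,
    Metric.isOpen_ball, Metric.mem_ball_self (by linarith)⟩
  intro p hp
  have h1 : dist x p ≤ dist x q := hmax hp
  have h2 := Metric.mem_ball.1 hz
  linarith [dist_triangle z x p]

theorem exists_dist_eq_one_of_mem_frontier [ProperSpace E] (h : IsUnitComplete C)
    {x : E} (hx : x ∈ frontier C) : ∃ y ∈ C, dist x y = 1 := by
  by_contra! hc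
  exact hx.2 (h.mem_interior_of_dist_ne_one hc (h.isClosed.frontier_subset hx))

variable [NormedSpace ℝ E]

theorem convex (h : IsUnitComplete C) : Convex ℝ C := by
  rw [h.eq_iInter]
  exact convex_iInter₂ fun _ _ => convex_closedBall _ _

theorem mem_frontier_of_dist_eq_one (h : IsUnitComplete C) {x y : E} (hx : x ∈ C) (hy : y ∈ C)
    (hxy : dist x y = 1) : x ∈ frontier C := by
  refine ⟨subset_closure hx, fun hint => ?_⟩
  have hcont : Filter.Tendsto (fun s : ℝ => x + s • (x - y)) (nhdsWithin 0 (Ioi 0))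
      (nhds x) := by
    have : Continuous fun s : ℝ => x + s • (x - y) := by fun_prop
    simpa using (this.tendsto 0).mono_left nhdsWithin_le_nhds
  obtain ⟨s, hs, hs0⟩ := ((hcont.eventually (mem_interior_iff_mem_nhds.1 hint)).and
    self_mem_nhdsWithin).exists
  have h1 := h.dist_le _ hs y hy
  have h2 : x + s • (x - y) - y = (1 + s) • (x - y) := by module
  have hs0' : (0 : ℝ) < s := hs0
  rw [dist_eq_norm, h2, norm_smul, ← dist_eq_norm, hxy, Real.norm_of_nonneg (by linarith)] at h1
  linarith

variable [ProperSpace E]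

theorem exists_dist_eq_one [Nontrivial E] (h : IsUnitComplete C) :
    ∃ x ∈ C, ∃ y ∈ C, dist x y = 1 := by
  have : (frontier C).Nonempty := by
    rw [nonempty_iff_ne_empty]
    intro h0
    rcases isClopen_iff.1 (isClopen_iff_frontier_eq_empty.2 h0) with h1 | h1
    · exact h.nonempty.ne_empty h1
    · exact NormedSpace.unbounded_univ ℝ E (h1 ▸ h.isBounded)
  obtain ⟨x, hx⟩ := this
  exact ⟨x, h.isClosed.frontier_subset hx, h.exists_dist_eq_one_of_mem_frontier hx⟩

theorem interior_nonempty [Nontrivial E] (h : IsUnitComplete C)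
    (hdim : Module.finrank ℝ E = 2) : (interior C).Nonempty := by
  have hfd : FiniteDimensional ℝ E := FiniteDimensional.of_finrank_pos (by omega)
  obtain ⟨a, ha, b, hb, hab⟩ := h.exists_dist_eq_one
  rw [dist_eq_norm] at hab
  have hmC : (1 / 2 : ℝ) • a + (1 / 2 : ℝ) • b ∈ C :=
    h.convex ha hb (by norm_num) (by norm_num) (by norm_num)
  by_contra hne
  have hspan : affineSpan ℝ C ≠ ⊤ := fun ht =>
    hne (h.convex.interior_nonempty_iff_affineSpan_eq_top.2 ht)
  -- the set lies on the line through `a` and `b`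
  have hline : ∀ p ∈ C, ∃ s : ℝ, p - b = s • (a - b) := by
    intro p hp
    by_contra! hs
    apply hspan
    have hdir : (affineSpan ℝ C).direction = ⊤ := by
      apply Submodule.eq_top_of_finrank_eq
      refine le_antisymm (Submodule.finrank_le _) ?_
      have hli : LinearIndependent ℝ ![a - b, p - b] := by
        rw [LinearIndependent.pair_iff' (by rw [← norm_ne_zero_iff, hab]; norm_num)]
        exact fun s => (hs s).symm
      have : _ = 2 := finrank_span_eq_card hli
      rw [hdim, ← this]
      apply Submodule.finrank_mono
      rw [Submodule.span_le]
      rintro _ ⟨i, rfl⟩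
      fin_cases i
      · exact AffineSubspace.vsub_mem_direction (subset_affineSpan ℝ C ha)
          (subset_affineSpan ℝ C hb)
      · exact AffineSubspace.vsub_mem_direction (subset_affineSpan ℝ C hp)
          (subset_affineSpan ℝ C hb)
    exact (AffineSubspace.direction_eq_top_iff_of_nonempty
      ⟨a, subset_affineSpan ℝ C ha⟩).1 hdir
  refine hne ⟨_, h.mem_interior_of_dist_ne_one (fun p hp => ne_of_lt ?_) hmC⟩
  obtain ⟨s, hs⟩ := hline p hp
  have e1 : p - a = (s - 1) • (a - b) := by linear_combination (norm := module) hs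
  have e2 : (1 / 2 : ℝ) • a + (1 / 2 : ℝ) • b - p = (1 / 2 - s) • (a - b) := by
    linear_combination (norm := module) (-1 : ℝ) • hs
  have n1 := h.dist_le p hp a ha
  have n2 := h.dist_le p hp b hb
  rw [dist_eq_norm, e1, norm_smul, hab, mul_one, Real.norm_eq_abs, abs_le] at n1
  rw [dist_eq_norm, hs, norm_smul, hab, mul_one, Real.norm_eq_abs, abs_le] at n2
  rw [dist_eq_norm, e2, norm_smul, hab, mul_one, Real.norm_eq_abs, abs_lt]
  constructor <;> linarith

/-- If finitely many points see every point having a diametral partner at distance one, then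
the set is the intersection of the unit balls around these points. -/
theorem eq_iInter_of_forall_exists [Nontrivial E] (h : IsUnitComplete C)
    (hdim : Module.finrank ℝ E = 2) {ι : Type*} [Finite ι] {v : ι → E} (hv : ∀ i, v i ∈ C)
    (hcov : ∀ x ∈ C, ∀ y ∈ C, dist x y = 1 → ∃ i, dist (v i) x = 1) :
    C = ⋂ i, Metric.closedBall (v i) 1 := by
  refine Subset.antisymm (fun z hz => mem_iInter.2 fun i => h.dist_le z hz _ (hv i)) ?_
  intro z hz
  rw [mem_iInter] at hz
  simp only [Metric.mem_closedBall] at hz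
  obtain ⟨o, ho⟩ := h.interior_nonempty hdim
  have hoC := interior_subset ho
  have hov : ∀ i, dist o (v i) < 1 := fun i => lt_of_le_of_ne (h.dist_le o hoC _ (hv i))
    fun h1 => (h.mem_frontier_of_dist_eq_one hoC (hv i) h1).2 ho
  let g : ℝ → E := fun t => o + t • (z - o)
  have hg : Continuous g := by fun_prop
  have hK : IsCompact (Icc (0 : ℝ) 1 ∩ g ⁻¹' C) :=
    isCompact_Icc.inter_right (h.isClosed.preimage hg)
  obtain ⟨t, ⟨⟨ht0, ht1⟩, htC⟩, hmax⟩ := hK.exists_isMaxOn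
    ⟨0, ⟨le_rfl, zero_le_one⟩, by simpa [g] using hoC⟩ continuousOn_id
  rcases ht1.eq_or_lt with rfl | ht1
  · simpa [g] using htC
  exfalso
  have hfr : g t ∈ frontier C := by
    refine ⟨subset_closure htC, fun hint => ?_⟩
    have hnear : ∀ᶠ s in nhdsWithin t (Ioi t), g s ∈ C ∧ s < 1 :=
      nhdsWithin_le_nhds ((hg.continuousAt.eventually (mem_interior_iff_mem_nhds.1 hint)).and
        (eventually_lt_nhds ht1))
    obtain ⟨s, ⟨hs1, hs2⟩, hs3⟩ := (hnear.and self_mem_nhdsWithin).exists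
    have hs3' : t < s := hs3
    have : s ≤ t := hmax ⟨⟨by linarith, hs2.le⟩, hs1⟩
    linarith
  obtain ⟨y, hy, hty⟩ := h.exists_dist_eq_one_of_mem_frontier hfr
  obtain ⟨i, hi⟩ := hcov _ htC y hy hty
  have e : g t - v i = (1 - t) • (o - v i) + t • (z - v i) := by simp only [g]; module
  have n1 := norm_add_le ((1 - t) • (o - v i)) (t • (z - v i))
  rw [← e, norm_smul, norm_smul, Real.norm_of_nonneg ht0, Real.norm_of_nonneg (by linarith),
    ← dist_eq_norm, ← dist_eq_norm, ← dist_eq_norm, dist_comm, hi] at n1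
  nlinarith [hov i, hz i]

theorem isPreconnected_frontier [Nontrivial E] (h : IsUnitComplete C)
    (hdim : Module.finrank ℝ E = 2) : IsPreconnected (frontier C) := by
  obtain ⟨e, -, -, he⟩ := exists_homeomorph_image_interior_closure_frontier_eq_unitBall
    h.convex (h.interior_nonempty hdim) h.isBounded
  rw [← e.isPreconnected_image, he]
  refine isPreconnected_sphere ?_ _ _
  exact Module.lt_rank_of_lt_finrank (by rw [hdim]; norm_num)

end IsUnitComplete

theorem IsCompact.exists_forall_add_le {X : Type*} [TopologicalSpace X] {K : Set X}
    (hK : IsCompact K) {f : X → ℝ} (hf : Continuous f) {c : ℝ} (h : ∀ x ∈ K, f x < c) :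
    ∃ δ > 0, ∀ x ∈ K, f x + δ ≤ c := by
  rcases K.eq_empty_or_nonempty with rfl | hne
  · exact ⟨1, one_pos, by simp⟩
  obtain ⟨q, hq, hmax⟩ := hK.exists_isMaxOn hne hf.continuousOn
  refine ⟨c - f q, by linarith [h q hq], fun x hx => ?_⟩
  have : f x ≤ f q := hmax hx
  linarith

/-- The graph on `C` joining points at distance at least `1 - ε`. -/
def almostDiamGraph {E : Type*} [MetricSpace E] (C : Set E) (ε : ℝ) : SimpleGraph E where
  Adj x y := x ∈ C ∧ y ∈ C ∧ x ≠ y ∧ 1 - ε ≤ dist x y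
  symm := ⟨fun _ _ h => ⟨h.2.1, h.1, h.2.2.1.symm, dist_comm (α := E) _ _ ▸ h.2.2.2⟩⟩
  loopless := ⟨fun _ h => h.2.2.1 rfl⟩

theorem almostDiamGraph_mono {E : Type*} [MetricSpace E] (C : Set E) {δ ε : ℝ} (h : δ ≤ ε) :
    almostDiamGraph C δ ≤ almostDiamGraph C ε :=
  fun _ _ hxy => ⟨hxy.1, hxy.2.1, hxy.2.2.1, by linarith [hxy.2.2.2]⟩

namespace IsUnitComplete

variable {E : Type*} [NormedAddCommGroup E] [NormedSpace ℝ E] {C : Set E}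

theorem eq_iInter_of_odd_closed_chain [ProperSpace E] [Nontrivial E] (h : IsUnitComplete C)
    (hdim : Module.finrank ℝ E = 2) {n : ℕ} (hn : Odd n) {v : ℕ → E} (hv : ∀ i, v i ∈ C)
    (hclosed : v n = v 0) (hdist : ∀ i < n, dist (v i) (v (i + 1)) = 1) :
    C = ⋂ i : Fin (n + 1), Metric.closedBall (v i) 1 := by
  refine h.eq_iInter_of_forall_exists hdim (v := fun i : Fin (n + 1) => v i)
    (fun i => hv i) ?_
  intro x hx y hy hxy
  by_contra! hne
  have hlt : ∀ i ≤ n, ‖v i - x‖ < 1 := fun i hi => by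
    rw [← dist_eq_norm]
    exact lt_of_le_of_ne (h.dist_le _ (hv i) _ hx) (hne ⟨i, by omega⟩)
  obtain ⟨f, hf⟩ := exists_lin_ker_span hdim (d := x - y) (by
    rw [← norm_ne_zero_iff, ← dist_eq_norm, hxy]; exact one_ne_zero)
  have hstep : ∀ i < n, f (v i - x) * f (v (i + 1) - x) < 0 := fun i hi =>
    mul_neg_of_diametral hf (by rw [← dist_eq_norm, hxy]) (by rw [← dist_eq_norm, hdist i hi])
      (by rw [← dist_eq_norm]; exact h.dist_le _ (hv i) _ hy)
      (by rw [← dist_eq_norm]; exact h.dist_le _ (hv _) _ hy) (hlt i hi.le) (hlt _ hi)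
  have h0 : f (v 0 - x) ≠ 0 := fun h0 => by
    have := hstep 0 hn.pos
    rw [h0, zero_mul] at this
    exact lt_irrefl _ this
  have halt : ∀ i ≤ n, 0 < (-1) ^ i * (f (v 0 - x) * f (v i - x)) := by
    intro i
    induction i with
    | zero => intro _; simpa using mul_self_pos.2 h0
    | succ i ih =>
      intro hi
      have h1 := ih (by omega)
      have h2 := hstep i hi
      have h3 := mul_pos_of_neg_of_neg (neg_neg_of_pos h1) h2
      have h4 : 0 < f (v i - x) ^ 2 := by
        refine sq_pos_of_ne_zero ?_
        intro h5
        rw [h5, zero_mul] at h2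
        exact lt_irrefl _ h2
      refine pos_of_mul_pos_left ?_ h4.le
      calc 0 < _ := h3
        _ = _ := by ring
  have hlast := halt n le_rfl
  rw [hclosed, hn.neg_one_pow] at hlast
  nlinarith [mul_self_nonneg (f (v 0 - x))]

theorem eventually_no_odd_closed_walk [ProperSpace E] [Nontrivial E] (h : IsUnitComplete C)
    (hdim : Module.finrank ℝ E = 2)
    (hnotR : ¬ ∃ (n : ℕ) (t : Fin n → E), 0 < n ∧ C = ⋂ i, Metric.closedBall (t i) 1)
    {n : ℕ} (hn : Odd n) :
    ∀ᶠ ε in nhdsWithin (0 : ℝ) (Ioi 0), ∀ x, ∀ p : (almostDiamGraph C ε).Walk x x,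
      p.length ≠ n := by
  let K : Set (ℕ → E) := {v | ∀ i, v i ∈ C} ∩ {v | v n = v 0}
  have hK : IsCompact K := by
    refine IsCompact.inter_right ?_ (isClosed_eq (continuous_apply n) (continuous_apply 0))
    simpa [Set.pi] using isCompact_univ_pi (fun _ : ℕ => h.isCompact)
  have hlt : ∀ v ∈ K, ∑ i ∈ Finset.range n, dist (v i) (v (i + 1)) < n := by
    rintro v ⟨hv, hcl⟩
    have hle : ∑ i ∈ Finset.range n, dist (v i) (v (i + 1)) ≤ ∑ i ∈ Finset.range n, (1 : ℝ) :=
      Finset.sum_le_sum fun i _ => h.dist_le _ (hv i) _ (hv (i + 1))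
    have hcard : ∑ i ∈ Finset.range n, (1 : ℝ) = n := by simp
    refine hcard ▸ lt_of_le_of_ne hle fun he => hnotR ⟨n + 1, fun i => v i, by omega, ?_⟩
    refine h.eq_iInter_of_odd_closed_chain hdim hn hv hcl fun i hi => ?_
    exact (Finset.sum_eq_sum_iff_of_le
      (fun i _ => h.dist_le _ (hv i) _ (hv (i + 1)))).1 he i (Finset.mem_range.2 hi)
  obtain ⟨δ, hδ, hsum⟩ := hK.exists_forall_add_le (by fun_prop) hlt
  have hn0 : (0 : ℝ) < n := by exact_mod_cast hn.pos
  filter_upwards [nhdsWithin_le_nhds (eventually_lt_nhds (div_pos hδ hn0))] with ε hε x p hp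
  have hadj : ∀ i < n, (almostDiamGraph C ε).Adj (p.getVert i) (p.getVert (i + 1)) :=
    fun i hi => p.adj_getVert_succ (hp ▸ hi)
  have hx : x ∈ C := by simpa using (hadj 0 hn.pos).1
  have hmem : (fun i => p.getVert i) ∈ K := by
    refine ⟨fun i => ?_, ?_⟩
    · rcases lt_or_ge i n with hi | hi
      · exact (hadj i hi).1
      · show p.getVert i ∈ C
        rw [p.getVert_of_length_le (hp ▸ hi)]
        exact hx
    · show p.getVert n = p.getVert 0
      rw [p.getVert_zero, p.getVert_of_length_le hp.le]
  have h1 := hsum _ hmem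
  have h2 : ∑ i ∈ Finset.range n, (1 - ε) ≤
      ∑ i ∈ Finset.range n, dist (p.getVert i) (p.getVert (i + 1)) :=
    Finset.sum_le_sum fun i hi => (hadj i (Finset.mem_range.1 hi)).2.2.2
  rw [Finset.sum_const, Finset.card_range, nsmul_eq_mul] at h2
  have h3 := (lt_div_iff₀ hn0).1 hε
  nlinarith

/-- Away from the points almost antipodal to `y`, almost diametral chords cross the line
through `y` along any fixed diametral chord `[x, y]`. -/
theorem exists_separation [ProperSpace E] (h : IsUnitComplete C)
    (hdim : Module.finrank ℝ E = 2) {x y : E} (hx : x ∈ C) (hxy : dist x y = 1)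
    {ε : ℝ} (hε : 0 < ε) :
    ∃ δ > 0, ∃ σ : E → Prop, ∀ a b, (almostDiamGraph C δ).Adj a b →
      dist a y ≤ 1 - ε → dist b y ≤ 1 - ε → (σ a ↔ ¬ σ b) := by
  have hyx : ‖y - x‖ = 1 := by rw [← dist_eq_norm, dist_comm, hxy]
  obtain ⟨f, hf⟩ := exists_lin_ker_span hdim (d := y - x) (by
    rw [← norm_ne_zero_iff, hyx]; exact one_ne_zero)
  have main : ∀ g : E →L[ℝ] ℝ, (∀ v, g v = 0 ↔ ∃ s : ℝ, v = s • (y - x)) →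
      ∃ δ > 0, ∀ a b, (almostDiamGraph C δ).Adj a b → dist a y ≤ 1 - ε → dist b y ≤ 1 - ε →
        0 ≤ g (a - y) → 0 ≤ g (b - y) → False := by
    intro g hg
    let K₀ : Set E := C ∩ ({a | dist a y ≤ 1 - ε} ∩ {a | 0 ≤ g (a - y)})
    have hK₀ : IsCompact K₀ := h.isCompact.inter_right
      ((isClosed_le (by fun_prop) (by fun_prop)).inter
        (isClosed_le (by fun_prop) (by fun_prop)))
    have hlt : ∀ q ∈ K₀ ×ˢ K₀, dist q.1 q.2 < 1 := by
      rintro ⟨a, b⟩ ⟨⟨ha, ha1, ha2⟩, ⟨hb, hb1, hb2⟩⟩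
      refine lt_of_le_of_ne (h.dist_le _ ha _ hb) fun he => ?_
      simp only [mem_ofPred_eq, dist_eq_norm] at ha1 ha2 hb1 hb2 he
      have hneg := mul_neg_of_diametral hg hyx he
        (by rw [← dist_eq_norm]; exact h.dist_le _ ha _ hx)
        (by rw [← dist_eq_norm]; exact h.dist_le _ hb _ hx) (by linarith) (by linarith)
      exact absurd (mul_nonneg ha2 hb2) (not_le.2 hneg)
    obtain ⟨δ, hδ, hK⟩ := (hK₀.prod hK₀).exists_forall_add_le (f := fun q => dist q.1 q.2)
      (by fun_prop) hlt
    refine ⟨δ / 2, by linarith, fun a b hab ha hb ha2 hb2 => ?_⟩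
    have := hK (a, b) ⟨⟨hab.1, ha, ha2⟩, ⟨hab.2.1, hb, hb2⟩⟩
    dsimp only at this
    linarith [hab.2.2.2]
  obtain ⟨δ₁, hδ₁, h₁⟩ := main f hf
  obtain ⟨δ₂, hδ₂, h₂⟩ := main (-f) fun v => by simpa using hf v
  refine ⟨min δ₁ δ₂, lt_min hδ₁ hδ₂, fun a => 0 ≤ f (a - y), fun a b hab ha hb => ?_⟩
  have k₁ := h₁ a b (almostDiamGraph_mono C (min_le_left _ _) hab) ha hb
  have k₂ := h₂ a b (almostDiamGraph_mono C (min_le_right _ _) hab) ha hb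
  refine ⟨k₁, fun hb' => ?_⟩
  by_contra ha'
  rw [not_le] at ha' hb'
  refine k₂ ?_ ?_
  · simpa only [neg_apply, neg_nonneg] using ha'.le
  · simpa only [neg_apply, neg_nonneg] using hb'.le

end IsUnitComplete

theorem IsUnitComplete.two_mul_add_one_le_of_cover {E : Type*} [NormedAddCommGroup E]
    [NormedSpace ℝ E] [ProperSpace E] [Nontrivial E] {C : Set E} (h : IsUnitComplete C)
    (hdim : Module.finrank ℝ E = 2) {k m : ℕ} (hk : 0 < k) {F : Fin m → Set E}
    (hFC : ∀ i, F i ⊆ C) (hF : ∀ i, Metric.diam (F i) < 1)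
    (hcov : ∀ x ∈ C, k ≤ {i : Fin m | x ∈ F i}.ncard) : 2 * k + 1 ≤ m := by
  by_contra hm
  let I : E → Set (Fin m) := fun x => {i | x ∈ closure (F i)}
  have hI : ∀ x ∈ C, k ≤ (I x).ncard := fun x hx =>
    (hcov x hx).trans (ncard_le_ncard (fun i hi => subset_closure hi) (toFinite _))
  have hdisj : ∀ x y, dist x y = 1 → Disjoint (I x) (I y) := by
    intro x y hxy
    rw [Set.disjoint_left]
    intro i hx hy
    have h1 := Metric.dist_le_diam_of_mem (h.isBounded.subset (hFC i)).closure hx hy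
    rw [Metric.diam_closure] at h1
    linarith [hF i]
  have hfr : ∀ x ∈ frontier C, x ∈ C := fun x hx => h.isClosed.frontier_subset hx
  have hcard : ∀ x ∈ frontier C, (I x).ncard = k := by
    intro x hx
    obtain ⟨y, hy, hxy⟩ := h.exists_dist_eq_one_of_mem_frontier hx
    have h1 := ncard_union_eq (hdisj x y hxy) (toFinite _) (toFinite _)
    have h2 := ncard_le_card (I x ∪ I y)
    rw [Nat.card_fin] at h2
    have h3 := hI x (hfr x hx)
    have h4 := hI y hy
    omega
  have hloc : ∀ x, ∀ᶠ z in nhds x, I z ⊆ I x := by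
    intro x
    refine Filter.eventually_all.2 fun i => ?_
    by_cases hi : x ∈ closure (F i)
    · exact Filter.Eventually.of_forall fun z _ => hi
    · filter_upwards [isClosed_closure.isOpen_compl.mem_nhds hi] with z hz hz'
      exact absurd hz' hz
  let _ : TopologicalSpace (Set (Fin m)) := ⊥
  have : DiscreteTopology (Set (Fin m)) := ⟨rfl⟩
  have hcont : ContinuousOn I (frontier C) := by
    intro x hx
    refine Filter.Tendsto.mono_right ?_ (pure_le_nhds (I x))
    refine Filter.tendsto_pure.2 ?_
    filter_upwards [self_mem_nhdsWithin, nhdsWithin_le_nhds (hloc x)] with z hz hzx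
    exact eq_of_subset_of_ncard_le hzx (by rw [hcard x hx, hcard z hz]) (toFinite _)
  obtain ⟨x, hx, y, hy, hxy⟩ := h.exists_dist_eq_one
  have hx' := h.mem_frontier_of_dist_eq_one hx hy hxy
  have hy' := h.mem_frontier_of_dist_eq_one hy hx (dist_comm x y ▸ hxy)
  have heq := (h.isPreconnected_frontier hdim).constant hcont hx' hy'
  have h0 := hdisj x y hxy
  rw [← heq, disjoint_self, bot_eq_empty, ← ncard_eq_zero, hcard x hx'] at h0
  omega

theorem IsUnitComplete.exists_cover {E : Type*} [NormedAddCommGroup E]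
    [NormedSpace ℝ E] [ProperSpace E] [Nontrivial E] {C : Set E} (h : IsUnitComplete C)
    (hdim : Module.finrank ℝ E = 2)
    (hnotR : ¬ ∃ (n : ℕ) (t : Fin n → E), 0 < n ∧ C = ⋂ i, Metric.closedBall (t i) 1)
    {k : ℕ} (hk : 0 < k) :
    ∃ F : Fin (2 * k + 1) → Set E, (∀ i, F i ⊆ C ∧ Metric.diam (F i) < 1) ∧
      ∀ x ∈ C, k ≤ {i | x ∈ F i}.ncard := by
  obtain ⟨x₀, hx₀, y, hy, hxy⟩ := h.exists_dist_eq_one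
  have hwalk : ∀ᶠ ε in nhdsWithin (0 : ℝ) (Ioi 0), ∀ j ∈ Finset.range k, ∀ x,
      ∀ p : (almostDiamGraph C ε).Walk x x, p.length ≠ 2 * (j + 1) + 1 :=
    (Filter.eventually_all_finset _).2 fun j _ =>
      h.eventually_no_odd_closed_walk hdim hnotR (odd_two_mul_add_one _)
  obtain ⟨ε, ⟨hε, hε1⟩, hε0⟩ := ((hwalk.and
    (nhdsWithin_le_nhds (eventually_lt_nhds one_pos))).and self_mem_nhdsWithin).exists
  replace hε0 : 0 < ε := hε0
  obtain ⟨δ₀, hδ₀, σ, hσ⟩ := h.exists_separation hdim hx₀ hxy hε0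
  let δ := min δ₀ ε
  have hδ : 0 < δ := lt_min hδ₀ hε0
  have hδε : δ ≤ ε := min_le_right _ _
  let X : Set E := {v | v ∈ C ∧ 1 - ε < dist v y}
  have hyX : ∀ v ∈ X, (almostDiamGraph C ε).Adj v y := by
    rintro v ⟨hv, hvy⟩
    exact ⟨hv, hy, dist_pos.1 (by linarith), hvy.le⟩
  obtain ⟨c, hc⟩ := exists_odd_cycle_coloring (almostDiamGraph C δ) X σ hk
    (fun a b hab ha hb => hσ a b (almostDiamGraph_mono C (min_le_left _ _) hab)
      (not_lt.1 fun h1 => ha ⟨hab.1, h1⟩) (not_lt.1 fun h1 => hb ⟨hab.2.1, h1⟩)) (by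
    intro j hj u hu w hw p hp
    refine hε j (Finset.mem_range.2 hj) y (.cons (hyX u hu).symm
      ((p.mapLe (almostDiamGraph_mono C hδε)).append (.cons (hyX w hw) .nil))) ?_
    simp only [SimpleGraph.Walk.length_cons, SimpleGraph.Walk.length_append,
      SimpleGraph.Walk.length_nil, SimpleGraph.Walk.length_map, hp]
    ring)
  refine ⟨fun i => {x | x ∈ C ∧ i ∈ stepTwo k (c x)}, fun i => ⟨fun x hx => hx.1, ?_⟩,
    fun x hx => ?_⟩
  · refine lt_of_le_of_lt (Metric.diam_le_of_forall_dist_le (C := 1 - δ) (by linarith) ?_)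
      (by linarith)
    rintro a ⟨ha, hai⟩ b ⟨hb, hbi⟩
    by_contra! hlt
    have hab : (almostDiamGraph C δ).Adj a b :=
      ⟨ha, hb, dist_pos.1 (by linarith), hlt.le⟩
    rcases hc a b hab with h1 | h1
    · exact Set.disjoint_left.1 (disjoint_stepTwo h1) hai hbi
    · exact Set.disjoint_left.1 (disjoint_stepTwo h1) hbi hai
  · refine (ncard_stepTwo k (c x)).symm.le.trans (le_of_eq ?_)
    congr 1
    ext i
    exact ⟨fun hi => ⟨hx, hi⟩, fun hi => hi.2⟩

theorem borsuk_not_reuleaux {E : Type*} [NormedAddCommGroup E] [NormedSpace ℝ E]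
    (hdim : Module.finrank ℝ E = 2)
    (C : Set E) (hC : IsDiamComplete C) (hd : Metric.diam C = 1)
    -- C is not a Reuleaux polygon
    (hnotR : ¬ ∃ (n : ℕ) (t : Fin n → E), 0 < n ∧
      C = ⋂ i, Metric.closedBall (t i) 1)
    (k : ℕ) (hk : 0 < k) :
    borsukNum C k = (2 * k + 1 : ℕ∞) := by
  have hfd : FiniteDimensional ℝ E := FiniteDimensional.of_finrank_pos (by omega)
  have hproper : ProperSpace E := FiniteDimensional.proper_real E
  have hnt : Nontrivial E := Module.nontrivial_of_finrank_pos (R := ℝ) (by omega)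
  have h := IsUnitComplete.of_isDiamComplete hC hd
  refine le_antisymm ?_ (le_sInf ?_)
  · obtain ⟨F, hF, hcov⟩ := h.exists_cover hdim hnotR hk
    refine sInf_le ⟨2 * k + 1, by push_cast; rfl, F, ?_, hcov⟩
    rwa [hd]
  · rintro _ ⟨m, rfl, F, hF, hcov⟩
    rw [hd] at hF
    exact_mod_cast h.two_mul_add_one_le_of_cover hdim hk (fun i => (hF i).1)
      (fun i => (hF i).2) hcov
end
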